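/- arXiv:2110.10785 — 4 statements merged into one kernel-verified Lean document; each statement's English description precedes it below -/
import Mathlib

section
/- Let n, d ≥ 1 be integers and let W = XᵀX be the n×n Wishart matrix, where X is a d×n matrix with i.i.d. standard normal entries. Let Θ = Θ₁ + iΘ₂, where Θ₁, Θ₂ are real symmetric n×n matrices and Id + Θ₂ + diag(Θ₂) is positive definite. Then E[exp(i⟨W,Θ⟩)] = det(Id − i(Θ + diag Θ))^{−d/2}, where the power w^{−d/2} is taken as exp(−(d/2)·tr(log M)) for M := Id − i(Θ + diag Θ) with log the principal matrix logarithm (well-defined since the Hermitian part of M is Id + Θ₂ + diag Θ₂ ≻ 0); equivalently, (E[exp(i⟨W,Θ⟩)])²·det(Id − i(Θ + diag Θ))^d = 1 and Θ ↦ E[exp(i⟨W,Θ⟩)] is analytic on this domain. -/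
open MeasureTheory Filter Topology ProbabilityTheory Matrix

noncomputable section

/-- The bilinear pairing `⟨M,N⟩ = ½·tr(MN + diag(M)·diag(N))` on complex `n×n` matrices. -/
def wPair {n : ℕ} (M N : Matrix (Fin n) (Fin n) ℂ) : ℂ :=
  (1 / 2 : ℂ) * ((M * N).trace + (Matrix.diagonal M.diag * Matrix.diagonal N.diag).trace)

/-- The law of a `d × n` matrix with i.i.d. standard normal entries. -/
def gaussMat (d n : ℕ) : Measure (Fin d → Fin n → ℝ) :=
  Measure.pi fun _ : Fin d => Measure.pi fun _ : Fin n => gaussianReal 0 1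

/-- The characteristic function `Θ ↦ E[exp(i⟨W,Θ⟩)]` of the Wishart matrix `W = XᵀX`,
where `X` is a `d × n` matrix of i.i.d. standard normals, evaluated at a complex symmetric
matrix `Θ`. -/
def wishartCF (d n : ℕ) (Θ : Matrix (Fin n) (Fin n) ℂ) : ℂ :=
  ∫ X : Fin d → Fin n → ℝ,
    Complex.exp (Complex.I *
      wPair (((Matrix.of X)ᵀ * Matrix.of X).map (fun r : ℝ => (r : ℂ))) Θ) ∂(gaussMat d n)

section GaussianIntegral

variable {ι : Type*} [Fintype ι]

theorem pi_gaussianReal_eq_withDensity :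
    Measure.pi (fun _ : ι => gaussianReal 0 1) =
      volume.withDensity fun x : ι → ℝ => ENNReal.ofReal (∏ i, gaussianPDFReal 0 1 (x i)) := by
  refine Measure.pi_eq (μ := fun _ : ι => gaussianReal 0 1) fun s hs => ?_
  have hint : ∀ i, Integrable (gaussianPDFReal 0 1) ((volume : Measure ℝ).restrict (s i)) :=
    fun i => (integrable_gaussianPDFReal 0 1).restrict
  rw [withDensity_apply _ (MeasurableSet.univ_pi hs), volume_pi, Measure.restrict_pi_pi,
    ← ofReal_integral_eq_lintegral_ofReal
      (Integrable.fintype_prod (μ := fun i => volume.restrict (s i)) hint)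
      (ae_of_all _ fun x => Finset.prod_nonneg fun i _ => gaussianPDFReal_nonneg _ _ _),
    integral_fintype_prod_eq_prod (𝕜 := ℝ) (μ := fun i => volume.restrict (s i))
      (fun _ => gaussianPDFReal 0 1),
    ENNReal.ofReal_prod_of_nonneg fun i _ =>
      integral_nonneg fun x => gaussianPDFReal_nonneg _ _ _]
  exact Finset.prod_congr rfl fun i _ => (gaussianReal_apply_eq_integral 0 one_ne_zero _).symm

theorem integral_pi_gaussianReal {E : Type*} [NormedAddCommGroup E] [NormedSpace ℝ E]
    (f : (ι → ℝ) → E) :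
    ∫ x, f x ∂Measure.pi (fun _ : ι => gaussianReal 0 1) =
      ∫ x, (∏ i, gaussianPDFReal 0 1 (x i)) • f x := by
  rw [pi_gaussianReal_eq_withDensity, integral_withDensity_eq_integral_toReal_smul]
  · refine integral_congr_ae (ae_of_all _ fun x => ?_)
    simp only
    rw [ENNReal.toReal_ofReal (Finset.prod_nonneg fun i _ => gaussianPDFReal_nonneg _ _ _)]
  · exact (Finset.measurable_prod _ fun i _ =>
      (measurable_gaussianPDFReal 0 1).comp (measurable_pi_apply i)).ennreal_ofReal
  · exact ae_of_all _ fun x => ENNReal.ofReal_lt_top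

/-- The complex quadratic form `x ↦ xᵀBx` restricted to real vectors. -/
def realQuadForm (B : Matrix ι ι ℂ) (x : ι → ℝ) : ℂ :=
  (fun i => (x i : ℂ)) ⬝ᵥ B *ᵥ (fun i => (x i : ℂ))

/-- The Gaussian integral `∫ exp(-xᵀBx/2) dx` of a complex quadratic form. -/
def quadGaussInt (B : Matrix ι ι ℂ) : ℂ :=
  ∫ x : ι → ℝ, Complex.exp (-(1 / 2) * realQuadForm B x)

theorem realQuadForm_eq_sum (B : Matrix ι ι ℂ) (x : ι → ℝ) :
    realQuadForm B x = ∑ i, ∑ j, B i j * x i * x j := by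
  simp only [realQuadForm, dotProduct, mulVec, Finset.mul_sum]
  exact Finset.sum_congr rfl fun i _ => Finset.sum_congr rfl fun j _ => by ring

theorem realQuadForm_mulVec (B : Matrix ι ι ℂ) (T : Matrix ι ι ℝ) (x : ι → ℝ) :
    realQuadForm B (T *ᵥ x) =
      realQuadForm ((T.map Complex.ofReal)ᵀ * B * T.map Complex.ofReal) x := by
  have h : (fun i => (((T *ᵥ x) i : ℝ) : ℂ)) = T.map Complex.ofReal *ᵥ fun i => (x i : ℂ) := by
    ext i
    simp [mulVec, dotProduct]
  rw [realQuadForm, realQuadForm, h, ← mulVec_mulVec, ← mulVec_mulVec, dotProduct_mulVec _ _ᵀ,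
    vecMul_transpose]

theorem realQuadForm_re (B : Matrix ι ι ℂ) (x : ι → ℝ) :
    (realQuadForm B x).re = x ⬝ᵥ B.map Complex.re *ᵥ x := by
  rw [realQuadForm_eq_sum]
  simp only [dotProduct, mulVec, Finset.mul_sum, Complex.re_sum, map_apply]
  refine Finset.sum_congr rfl fun i _ => Finset.sum_congr rfl fun j _ => ?_
  rw [Complex.re_mul_ofReal, Complex.re_mul_ofReal]
  ring

variable [DecidableEq ι]

open scoped MatrixOrder ComplexOrder in
/-- Simultaneous diagonalization of the real and imaginary parts of a complex symmetric matrix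
with positive definite real part. -/
theorem exists_real_congruence_diagonal {B : Matrix ι ι ℂ} (hB : B.IsSymm)
    (hpos : (B.map Complex.re).PosDef) :
    ∃ (T : Matrix ι ι ℝ) (z : ι → ℂ), T.det ≠ 0 ∧ (∀ i, (z i).re = 1) ∧
      (T.map Complex.ofReal)ᵀ * B * T.map Complex.ofReal = diagonal z := by
  obtain ⟨y, hy, hyP⟩ :=
    CStarAlgebra.isStrictlyPositive_iff_eq_star_mul_self.mp hpos.isStrictlyPositive
  rw [star_eq_conjTranspose, conjTranspose_eq_transpose_of_trivial] at hyP
  have hdet : IsUnit y.det := (isUnit_iff_isUnit_det y).mp hy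
  set U := y⁻¹
  have hUP : Uᵀ * B.map Complex.re * U = 1 := by
    rw [hyP, Matrix.mul_assoc, Matrix.mul_assoc, mul_nonsing_inv _ hdet, Matrix.mul_one,
      ← transpose_mul, mul_nonsing_inv _ hdet, transpose_one]
  have hQ : (Uᵀ * B.map Complex.im * U).IsHermitian := by
    have hs : (B.map Complex.im)ᵀ = B.map Complex.im := by
      rw [← transpose_map, hB.eq]
    rw [IsHermitian, conjTranspose_eq_transpose_of_trivial, transpose_mul, transpose_mul,
      transpose_transpose, hs, Matrix.mul_assoc]
  set O : Matrix ι ι ℝ := (hQ.eigenvectorUnitary : Matrix ι ι ℝ)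
  have hOO : Oᵀ * O = 1 := by
    have := Unitary.coe_star_mul_self hQ.eigenvectorUnitary
    rwa [star_eq_conjTranspose, conjTranspose_eq_transpose_of_trivial] at this
  have hOQ : Oᵀ * (Uᵀ * B.map Complex.im * U) * O = diagonal hQ.eigenvalues := by
    have := hQ.conjStarAlgAut_star_eigenvectorUnitary
    rw [Unitary.conjStarAlgAut_star_apply, star_eq_conjTranspose,
      conjTranspose_eq_transpose_of_trivial] at this
    exact this
  refine ⟨U * O, fun i => 1 + hQ.eigenvalues i * Complex.I, ?_, fun i => by simp, ?_⟩
  · have h1 : O.det ≠ 0 := by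
      intro h
      have := congrArg det hOO
      simp [h] at this
    rw [det_mul]
    refine mul_ne_zero ?_ h1
    exact ((isUnit_nonsing_inv_det_iff (A := y)).mpr hdet).ne_zero
  · have hBdec : B = (B.map Complex.re).map Complex.ofReal +
        Complex.I • (B.map Complex.im).map Complex.ofReal := by
      ext i j
      simp [mul_comm Complex.I, Complex.re_add_im]
    have hmul : ∀ M N : Matrix ι ι ℝ, (M * N).map Complex.ofReal =
        M.map Complex.ofReal * N.map Complex.ofReal := fun M N =>
      Matrix.map_mul (f := Complex.ofRealHom)
    have h1 : (U * O)ᵀ * B.map Complex.re * (U * O) = 1 := by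
      calc (U * O)ᵀ * B.map Complex.re * (U * O) = Oᵀ * (Uᵀ * B.map Complex.re * U) * O := by
            rw [transpose_mul]; simp only [Matrix.mul_assoc]
        _ = 1 := by rw [hUP, Matrix.mul_one, hOO]
    have h2 : (U * O)ᵀ * B.map Complex.im * (U * O) = diagonal hQ.eigenvalues := by
      rw [← hOQ, transpose_mul]
      simp only [Matrix.mul_assoc]
    conv_lhs => rw [hBdec]
    rw [← transpose_map, Matrix.mul_add, Matrix.add_mul, Matrix.mul_smul, Matrix.smul_mul,
      ← hmul, ← hmul, ← hmul, ← hmul, h1, h2]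
    ext i j
    by_cases hij : i = j
    · subst hij; simp [mul_comm]
    · simp [hij]

theorem quadGaussInt_congruence (B : Matrix ι ι ℂ) {T : Matrix ι ι ℝ} (hT : T.det ≠ 0) :
    quadGaussInt B =
      |T.det| * quadGaussInt ((T.map Complex.ofReal)ᵀ * B * T.map Complex.ofReal) := by
  have hcont : Continuous fun x : ι → ℝ => Complex.exp (-(1 / 2) * realQuadForm B x) := by
    simp only [realQuadForm_eq_sum]
    fun_prop
  have hmap := Real.map_matrix_volume_pi_eq_smul_volume_pi hT
  have h := integral_map (μ := (volume : Measure (ι → ℝ))) (φ := toLin' T)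
    (toLin' T).continuous_of_finiteDimensional.aemeasurable hcont.aestronglyMeasurable
  rw [hmap, integral_smul_measure, ENNReal.toReal_ofReal (abs_nonneg _), abs_inv] at h
  simp only [toLin'_apply, realQuadForm_mulVec] at h
  rw [quadGaussInt, quadGaussInt, ← h, Complex.real_smul, ← mul_assoc, ← Complex.ofReal_mul,
    mul_inv_cancel₀ (abs_ne_zero.mpr hT), Complex.ofReal_one, one_mul]

theorem quadGaussInt_diagonal {z : ι → ℂ} (hz : ∀ i, 0 < (z i).re) :
    quadGaussInt (diagonal z) ^ 2 * ∏ i, z i = (2 * Real.pi : ℂ) ^ Fintype.card ι := by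
  have h1 : quadGaussInt (diagonal z) = ∏ i, ((Real.pi / (z i / 2) : ℂ) ^ (1 / 2 : ℂ)) := by
    have : ∀ x : ι → ℝ, Complex.exp (-(1 / 2) * realQuadForm (diagonal z) x) =
        ∏ i, Complex.exp (-(z i / 2) * (x i : ℂ) ^ 2) := by
      intro x
      rw [← Complex.exp_sum, realQuadForm, dotProduct, Finset.mul_sum]
      congr 1
      refine Finset.sum_congr rfl fun i _ => ?_
      rw [mulVec_diagonal]
      ring
    rw [quadGaussInt]
    simp only [this]
    rw [integral_fintype_prod_volume_eq_prod fun i (t : ℝ) =>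
      Complex.exp (-(z i / 2) * (t : ℂ) ^ 2)]
    refine Finset.prod_congr rfl fun i _ => integral_gaussian_complex ?_
    simpa using hz i
  rw [h1, ← Finset.prod_pow, ← Finset.prod_mul_distrib, ← Finset.card_univ, ← Finset.prod_const]
  refine Finset.prod_congr rfl fun i _ => ?_
  have hzi : z i ≠ 0 := fun h => by simpa [h] using hz i
  rw [one_div, show (2 : ℂ)⁻¹ = ((2 : ℕ) : ℂ)⁻¹ by norm_num, Complex.cpow_nat_inv_pow _ two_ne_zero]
  field_simp

theorem quadGaussInt_sq_mul_det {B : Matrix ι ι ℂ} (hB : B.IsSymm)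
    (hpos : (B.map Complex.re).PosDef) :
    quadGaussInt B ^ 2 * B.det = (2 * Real.pi : ℂ) ^ Fintype.card ι := by
  obtain ⟨T, z, hT, hz, hdiag⟩ := exists_real_congruence_diagonal hB hpos
  have hd := congrArg det hdiag
  have hTc : (T.map Complex.ofReal).det = (T.det : ℂ) :=
    (RingHom.map_det Complex.ofRealHom T).symm
  rw [det_mul, det_mul, det_transpose, det_diagonal, hTc] at hd
  rw [quadGaussInt_congruence B hT, hdiag, ← quadGaussInt_diagonal (z := z) fun i => by simp [hz i],
    ← hd, mul_pow, ← Complex.ofReal_pow, sq_abs, Complex.ofReal_pow]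
  ring

open scoped MatrixOrder ComplexOrder in
theorem exists_coercive {P : Matrix ι ι ℝ} (hP : P.PosDef) :
    ∃ ε > 0, ∀ x : ι → ℝ, ε * ∑ i, x i ^ 2 ≤ x ⬝ᵥ P *ᵥ x := by
  obtain ⟨y, hy, rfl⟩ :=
    CStarAlgebra.isStrictlyPositive_iff_eq_star_mul_self.mp hP.isStrictlyPositive
  rw [star_eq_conjTranspose, conjTranspose_eq_transpose_of_trivial]
  have hdet : IsUnit y.det := (isUnit_iff_isUnit_det y).mp hy
  set C : ℝ := ∑ i, ∑ j, y⁻¹ i j ^ 2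
  have hC : 0 ≤ C := Finset.sum_nonneg fun i _ => Finset.sum_nonneg fun j _ => sq_nonneg _
  refine ⟨(C + 1)⁻¹, by positivity, fun x => ?_⟩
  set w := y *ᵥ x with hw
  have hxw : x = y⁻¹ *ᵥ w := by
    rw [hw, mulVec_mulVec, nonsing_inv_mul _ hdet, one_mulVec]
  have hq : x ⬝ᵥ (yᵀ * y) *ᵥ x = ∑ i, w i ^ 2 := by
    rw [← mulVec_mulVec, dotProduct_mulVec, vecMul_transpose, ← hw]
    simp only [dotProduct, sq]
  have hw0 : 0 ≤ ∑ i, w i ^ 2 := Finset.sum_nonneg fun i _ => sq_nonneg _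
  have hx : ∑ i, x i ^ 2 ≤ C * ∑ i, w i ^ 2 := by
    rw [Finset.sum_mul]
    refine Finset.sum_le_sum fun i _ => ?_
    rw [hxw]
    exact Finset.sum_mul_sq_le_sq_mul_sq _ _ _
  rw [hq, inv_mul_le_iff₀ (by positivity)]
  linarith

omit [DecidableEq ι] in
theorem abs_dotProduct_mulVec_le {D : Matrix ι ι ℝ} {δ : ℝ} (hD : ∀ i j, |D i j| ≤ δ)
    (x : ι → ℝ) : |x ⬝ᵥ D *ᵥ x| ≤ δ * Fintype.card ι * ∑ i, x i ^ 2 := by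
  have h : ∀ i j, |x i * (D i j * x j)| ≤ δ * ((x i ^ 2 + x j ^ 2) / 2) := by
    intro i j
    have h1 : |x i * x j| ≤ (x i ^ 2 + x j ^ 2) / 2 :=
      abs_le.mpr ⟨by nlinarith [sq_nonneg (x i + x j)], by nlinarith [sq_nonneg (x i - x j)]⟩
    calc |x i * (D i j * x j)| = |D i j| * |x i * x j| := by
          rw [← abs_mul]; congr 1; ring
      _ ≤ _ := mul_le_mul (hD i j) h1 (abs_nonneg _) ((abs_nonneg _).trans (hD i j))
  simp only [dotProduct, mulVec, Finset.mul_sum]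
  calc |∑ i, ∑ j, x i * (D i j * x j)| ≤ ∑ i, ∑ j, |x i * (D i j * x j)| :=
        (Finset.abs_sum_le_sum_abs _ _).trans
          (Finset.sum_le_sum fun i _ => Finset.abs_sum_le_sum_abs _ _)
    _ ≤ ∑ i, ∑ j, δ * ((x i ^ 2 + x j ^ 2) / 2) :=
        Finset.sum_le_sum fun i _ => Finset.sum_le_sum fun j _ => h i j
    _ = _ := by
        simp only [← Finset.mul_sum, ← Finset.sum_div, Finset.sum_add_distrib, Finset.sum_const,
          Finset.card_univ, nsmul_eq_mul]
        ring

theorem quadGaussInt_continuousAt {X : Type*} [TopologicalSpace X] [FirstCountableTopology X]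
    {B : X → Matrix ι ι ℂ} {a : X} (hB : ∀ i j, ContinuousAt (fun x => B x i j) a)
    (hpos : ((B a).map Complex.re).PosDef) :
    ContinuousAt (fun x => quadGaussInt (B x)) a := by
  obtain ⟨ε, hε, hcoer⟩ := exists_coercive hpos
  set δ : ℝ := ε / (2 * (Fintype.card ι + 1)) with hδ
  have hδ0 : 0 < δ := by positivity
  have hδε : δ * Fintype.card ι ≤ ε / 2 := by
    rw [hδ, div_mul_eq_mul_div, div_le_div_iff₀ (by positivity) two_pos]
    nlinarith
  have hnear : ∀ᶠ t in 𝓝 a, ∀ i j, |(B t i j).re - (B a i j).re| ≤ δ := by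
    refine eventually_all.mpr fun i => eventually_all.mpr fun j => ?_
    have := (Complex.continuous_re.continuousAt.comp (hB i j)).eventually
      (Metric.closedBall_mem_nhds _ hδ0)
    filter_upwards [this] with t ht
    simpa [Real.dist_eq] using ht
  refine continuousAt_of_dominated
    (bound := fun x => ∏ i, Real.exp (-(ε / 4) * x i ^ 2)) ?_ ?_ ?_ ?_
  · refine Eventually.of_forall fun t => Continuous.aestronglyMeasurable ?_
    simp only [realQuadForm_eq_sum]
    fun_prop
  · filter_upwards [hnear] with t ht
    refine ae_of_all _ fun x => ?_
    rw [Complex.norm_exp, ← Real.exp_sum, ← Finset.mul_sum, Real.exp_le_exp]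
    have hre : (-(1 / 2) * realQuadForm (B t) x).re = -(1 / 2) * (realQuadForm (B t) x).re := by
      simp
    rw [hre, realQuadForm_re]
    have h1 := abs_dotProduct_mulVec_le (D := (B t).map Complex.re - (B a).map Complex.re)
      (by simpa using ht) x
    rw [sub_mulVec, dotProduct_sub] at h1
    have h2 := (abs_le.mp h1).1
    have h3 : δ * Fintype.card ι * ∑ i, x i ^ 2 ≤ ε / 2 * ∑ i, x i ^ 2 :=
      mul_le_mul_of_nonneg_right hδε (Finset.sum_nonneg fun i _ => sq_nonneg _)
    linarith [hcoer x]
  · rw [volume_pi]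
    exact Integrable.fintype_prod (μ := fun _ : ι => (volume : Measure ℝ))
      fun i => integrable_exp_neg_mul_sq (by positivity)
  · refine ae_of_all _ fun x => ?_
    simp only [realQuadForm_eq_sum]
    fun_prop

end GaussianIntegral

theorem wPair_gram {d n : ℕ} (X : Fin d → Fin n → ℝ) (Θ : Matrix (Fin n) (Fin n) ℂ) :
    wPair (((Matrix.of X)ᵀ * Matrix.of X).map (fun r : ℝ => (r : ℂ))) Θ =
      ∑ k, (1 / 2 : ℂ) * realQuadForm (Θᵀ + diagonal Θ.diag) (X k) := by
  have h1 : (((Matrix.of X)ᵀ * Matrix.of X).map (fun r : ℝ => (r : ℂ)) * Θ).trace =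
      ∑ k, realQuadForm Θᵀ (X k) := by
    simp only [realQuadForm_eq_sum, trace, diag_apply, mul_apply, map_apply, transpose_apply,
      of_apply, Complex.ofReal_sum, Complex.ofReal_mul, Finset.sum_mul]
    rw [Finset.sum_comm_cycle]
    exact Finset.sum_congr rfl fun k _ => Finset.sum_congr rfl fun i _ =>
      Finset.sum_congr rfl fun j _ => by ring
  have h2 : (diagonal (((Matrix.of X)ᵀ * Matrix.of X).map (fun r : ℝ => (r : ℂ))).diag *
      diagonal Θ.diag).trace = ∑ k, realQuadForm (diagonal Θ.diag) (X k) := by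
    simp only [realQuadForm, dotProduct, mulVec_diagonal, diagonal_mul_diagonal, trace_diagonal,
      diag_apply, map_apply, mul_apply, transpose_apply, of_apply, Complex.ofReal_sum,
      Complex.ofReal_mul, Finset.sum_mul]
    rw [Finset.sum_comm]
    exact Finset.sum_congr rfl fun k _ => Finset.sum_congr rfl fun i _ => by ring
  have h3 : ∀ k, realQuadForm (Θᵀ + diagonal Θ.diag) (X k) =
      realQuadForm Θᵀ (X k) + realQuadForm (diagonal Θ.diag) (X k) := fun k => by
    simp only [realQuadForm, add_mulVec, dotProduct_add]
  simp only [wPair, h1, h2, h3, ← Finset.mul_sum, Finset.sum_add_distrib]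

theorem gaussian_expectation_realQuadForm {ι : Type*} [Fintype ι] [DecidableEq ι]
    (A : Matrix ι ι ℂ) :
    ∫ x, Complex.exp (Complex.I * ((1 / 2) * realQuadForm A x))
        ∂Measure.pi (fun _ : ι => gaussianReal 0 1) =
      ((√(2 * Real.pi))⁻¹ : ℂ) ^ Fintype.card ι * quadGaussInt (1 - Complex.I • A) := by
  rw [integral_pi_gaussianReal, quadGaussInt, ← integral_const_mul]
  refine integral_congr_ae (ae_of_all _ fun x => ?_)
  have hq : realQuadForm (1 - Complex.I • A) x =
      ∑ i, (x i : ℂ) ^ 2 - Complex.I * realQuadForm A x := by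
    simp only [realQuadForm, sub_mulVec, one_mulVec, smul_mulVec, dotProduct_sub, dotProduct_smul,
      smul_eq_mul]
    simp only [dotProduct, sq]
  have hpdf : ((∏ i, gaussianPDFReal 0 1 (x i) : ℝ) : ℂ) =
      ((√(2 * Real.pi))⁻¹ : ℂ) ^ Fintype.card ι * Complex.exp (-(1 / 2) * ∑ i, (x i : ℂ) ^ 2) := by
    rw [Finset.mul_sum, Complex.exp_sum, ← Finset.card_univ, ← Finset.prod_const,
      ← Finset.prod_mul_distrib, Complex.ofReal_prod]
    refine Finset.prod_congr rfl fun i _ => ?_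
    rw [gaussianPDFReal]
    push_cast
    congr 2
    · simp
    · ring
  simp only
  rw [Complex.real_smul, hpdf, hq, mul_assoc, ← Complex.exp_add]
  congr 2
  ring

/-- For symmetric `Θ`, the characteristic function is a power of a complex Gaussian integral. -/
theorem wishartCF_eq {d n : ℕ} {Θ : Matrix (Fin n) (Fin n) ℂ} (hΘ : Θ.IsSymm) :
    wishartCF d n Θ = (((√(2 * Real.pi))⁻¹ : ℂ) ^ n *
      quadGaussInt (1 - Complex.I • (Θ + diagonal Θ.diag))) ^ d := by
  have h := gaussian_expectation_realQuadForm (Θ + diagonal Θ.diag)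
  rw [Fintype.card_fin] at h
  rw [wishartCF, gaussMat, ← h]
  simp only [wPair_gram, hΘ.eq, Finset.mul_sum, Complex.exp_sum]
  rw [integral_fintype_prod_eq_pow (fun x => Complex.exp (Complex.I * (1 / 2 *
    realQuadForm (Θ + diagonal Θ.diag) x))), Fintype.card_fin]

theorem re_one_sub_I_smul {n : ℕ} (Θ : Matrix (Fin n) (Fin n) ℂ) :
    (1 - Complex.I • (Θ + diagonal Θ.diag)).map Complex.re =
      1 + Θ.map Complex.im + diagonal (fun i => (Θ i i).im) := by
  ext i j
  by_cases hij : i = j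
  · subst hij
    simp
    ring
  · simp [hij]

theorem wishartCF_sq_mul_det {d n : ℕ} {Θ : Matrix (Fin n) (Fin n) ℂ} (hΘ : Θ.IsSymm)
    (hpos : (1 + Θ.map Complex.im + diagonal (fun i => (Θ i i).im)).PosDef) :
    wishartCF d n Θ ^ 2 * (1 - Complex.I • (Θ + diagonal Θ.diag)).det ^ d = 1 := by
  have hsymm : (1 - Complex.I • (Θ + diagonal Θ.diag)).IsSymm := by
    simp [IsSymm, hΘ.eq]
  have h := quadGaussInt_sq_mul_det hsymm (by rwa [re_one_sub_I_smul])
  rw [Fintype.card_fin] at h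
  have hsq : (((√(2 * Real.pi))⁻¹ : ℂ)) ^ 2 * (2 * Real.pi) = 1 := by
    have h2 : ((√(2 * Real.pi) : ℝ) : ℂ) ^ 2 = 2 * Real.pi := by
      rw [← Complex.ofReal_pow, Real.sq_sqrt (by positivity)]
      push_cast
      rfl
    rw [inv_pow, h2, inv_mul_cancel₀]
    simp [Real.pi_ne_zero]
  rw [wishartCF_eq hΘ, ← pow_mul, mul_comm d 2, pow_mul, ← mul_pow, mul_pow _ _ 2, mul_assoc, h,
    ← pow_mul, mul_comm n 2, pow_mul, ← mul_pow, hsq, one_pow, one_pow]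

/-- A function continuous within `s` whose square times an analytic function is one is analytic
within `s`. -/
theorem AnalyticWithinAt.of_sq_mul_eq_one {E : Type*} [NormedAddCommGroup E] [NormedSpace ℂ E]
    {f D : E → ℂ} {s : Set E} {a : E} (ha : a ∈ s) (hf : ContinuousWithinAt f s a)
    (hD : AnalyticAt ℂ D a) (h : ∀ x ∈ s, f x ^ 2 * D x = 1) : AnalyticWithinAt ℂ f s a := by
  have hfa : f a ≠ 0 := fun h0 => by simpa [h0] using h a ha
  have hDa : D a ≠ 0 := fun h0 => by simpa [h0] using h a ha
  have hg : AnalyticAt ℂ (fun x => f a * (D a * (D x)⁻¹) ^ (2⁻¹ : ℂ)) a := by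
    refine analyticAt_const.mul (AnalyticAt.cpow ?_ analyticAt_const ?_)
    · exact analyticAt_const.mul (hD.inv hDa)
    · simp [hDa]
  refine hg.analyticWithinAt.congr_of_eventuallyEq_insert ?_
  rw [Set.insert_eq_of_mem ha]
  have hre : ∀ᶠ x in 𝓝[s] a, 0 < (f x / f a).re := by
    have : Tendsto (fun x => (f x / f a).re) (𝓝[s] a) (𝓝 (f a / f a).re) :=
      (Complex.continuous_re.tendsto _).comp (hf.tendsto.div_const _)
    refine this.eventually (lt_mem_nhds ?_)
    simp [hfa]
  filter_upwards [hre, self_mem_nhdsWithin] with x hx hxs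
  have hfx : f x ≠ 0 := fun h0 => by simpa [h0] using h x hxs
  have hDx : D x ≠ 0 := fun h0 => by simpa [h0] using h x hxs
  have hquot : D a * (D x)⁻¹ = (f x / f a) ^ 2 := by
    field_simp
    linear_combination h a ha - h x hxs
  rw [hquot, Complex.sq_cpow_two_inv hx, mul_div_cancel₀ _ hfa]

theorem wishartCF_analyticOn (n d : ℕ) :
    AnalyticOn ℂ (fun M : Fin n → Fin n → ℂ => wishartCF d n (Matrix.of M))
      {M : Fin n → Fin n → ℂ | (Matrix.of M).IsSymm ∧
        ((1 : Matrix (Fin n) (Fin n) ℝ) + Matrix.of (fun i j => (M i j).im) +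
          Matrix.diagonal (fun i => (M i i).im)).PosDef} := by
  intro M hM
  refine AnalyticWithinAt.of_sq_mul_eq_one (D := fun M : Fin n → Fin n → ℂ =>
    (1 - Complex.I • (Matrix.of M + diagonal (Matrix.of M).diag)).det ^ d) hM ?_ ?_ ?_
  · have hcont : ContinuousAt (fun M : Fin n → Fin n → ℂ => (((√(2 * Real.pi))⁻¹ : ℂ) ^ n *
        quadGaussInt (1 - Complex.I • (Matrix.of M + diagonal (Matrix.of M).diag))) ^ d) M := by
      refine (continuousAt_const.mul (quadGaussInt_continuousAt (fun i j => ?_) ?_)).pow d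
      · simp only [Matrix.sub_apply, Matrix.smul_apply, Matrix.add_apply, of_apply, diagonal_apply, diag_apply]
        have hentry : ∀ i j, ContinuousAt (fun N : Fin n → Fin n → ℂ => N i j) M :=
          fun i j => (continuous_apply_apply i j).continuousAt
        refine continuousAt_const.sub (((hentry i j).fun_add ?_).fun_const_smul _)
        by_cases hij : i = j
        · simp only [hij, if_true]; exact hentry _ _
        · simp only [hij, if_false]; exact continuousAt_const
      · rw [re_one_sub_I_smul]
        exact hM.2
    exact hcont.continuousWithinAt.congr (fun N hN => wishartCF_eq hN.1) (wishartCF_eq hM.1)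
  · simp only [det_apply, Matrix.sub_apply, Matrix.smul_apply, Matrix.add_apply, of_apply, diagonal_apply, diag_apply]
    have hentry : ∀ i j, AnalyticAt ℂ (fun N : Fin n → Fin n → ℂ => N i j) M := fun i j =>
      ((ContinuousLinearMap.proj (R := ℂ) (φ := fun _ : Fin n => ℂ) j).comp
        (ContinuousLinearMap.proj (R := ℂ) (φ := fun _ : Fin n => Fin n → ℂ) i)).analyticAt M
    refine AnalyticAt.pow (Finset.analyticAt_fun_sum _ fun σ _ => ?_) d
    refine AnalyticAt.const_smul (Finset.analyticAt_fun_prod _ fun i _ => ?_)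
    refine analyticAt_const.sub (AnalyticAt.fun_const_smul ((hentry _ _).fun_add ?_))
    by_cases hij : σ i = i
    · simp only [hij, if_true]; exact hentry _ _
    · simp only [hij, if_false]; exact analyticAt_const
  · exact fun N hN => wishartCF_sq_mul_det hN.1 hN.2

/-- **Lemma on the Wishart characteristic function.**
For `Θ = Θ₁ + iΘ₂` with `Θ₁, Θ₂` real symmetric and `Id + Θ₂ + diag Θ₂ ≻ 0`:
`E[exp(i⟨W,Θ⟩)] = det(Id − i(Θ + diag Θ))^{−d/2}` (principal branch); equivalently
`(E[exp(i⟨W,Θ⟩)])² · det(Id − i(Θ + diag Θ))^d = 1`, and the characteristic function is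
analytic in `Θ` on this domain. -/
theorem wishart_characteristic_function
    (n d : ℕ) (hn : 1 ≤ n) (hd : 1 ≤ d)
    (Θ₁ Θ₂ : Matrix (Fin n) (Fin n) ℝ) (h1 : Θ₁.IsSymm) (h2 : Θ₂.IsSymm)
    (hpos : (1 + Θ₂ + Matrix.diagonal Θ₂.diag).PosDef) :
    (wishartCF d n
          (Θ₁.map (fun r : ℝ => (r : ℂ)) + Complex.I • Θ₂.map (fun r : ℝ => (r : ℂ)))) ^ 2 *
        (Matrix.det (1 - Complex.I •
          ((Θ₁.map (fun r : ℝ => (r : ℂ)) + Complex.I • Θ₂.map (fun r : ℝ => (r : ℂ))) +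
            Matrix.diagonal
              (Θ₁.map (fun r : ℝ => (r : ℂ)) +
                Complex.I • Θ₂.map (fun r : ℝ => (r : ℂ))).diag))) ^ d = 1 ∧
    AnalyticOn ℂ (fun M : Fin n → Fin n → ℂ => wishartCF d n (Matrix.of M))
      {M : Fin n → Fin n → ℂ | (Matrix.of M).IsSymm ∧
        ((1 : Matrix (Fin n) (Fin n) ℝ) + Matrix.of (fun i j => (M i j).im) +
          Matrix.diagonal (fun i => (M i i).im)).PosDef} := by
  refine ⟨wishartCF_sq_mul_det ?_ ?_, wishartCF_analyticOn n d⟩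
  · rw [IsSymm, transpose_add, transpose_smul, ← transpose_map, ← transpose_map, h1.eq, h2.eq]
  · convert hpos using 2
    · congr 1
      ext i j
      simp
    · congr 1
      ext i
      simp

end
end

section
/- For every integer d ≥ 3, the function η_d(u) := Γ(d/2+1)/(2π·(d/2)^{d/2}) · (exp(u·cot u)·sinc u)^{d/2} is a probability density on (−π,π); that is, η_d ≥ 0 and ∫_{−π}^{π} (exp(u·cot u)·sinc u)^{d/2} du = 2π·(d/2)^{d/2}/Γ(d/2+1). -/
open MeasureTheory Filter Topology

noncomputable section

/-- `sinc u = sin u / u`, with `sinc 0 = 1`. -/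
def sincR (u : ℝ) : ℝ := if u = 0 then 1 else Real.sin u / u

/-- The density `η_d(u) = Γ(d/2+1)/(2π (d/2)^{d/2}) (exp(u cot u) sinc u)^{d/2}`
on `(−π, π)` (extended by `0` outside). -/
def etaDen (d : ℕ) (u : ℝ) : ℝ :=
  Set.indicator (Set.Ioo (-Real.pi) Real.pi)
    (fun u => Real.Gamma ((d : ℝ) / 2 + 1) / (2 * Real.pi * ((d : ℝ) / 2) ^ ((d : ℝ) / 2)) *
      (Real.exp (u * (Real.cos u / Real.sin u)) * sincR u) ^ ((d : ℝ) / 2)) u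

open Real in
/-- The phase-free part `exp (t * u cot u) (sin u / u) ^ s` of the Hankel integrand along the
steepest-descent curve `w = u cot u + i u`. -/
def hankelWeight (t s u : ℝ) : ℝ := exp (t * (u * (cos u / sin u)) + s * log (sin u / u))

open Real in
/-- The integrand of `Im ∫ exp (t w) w ^ (-s-1) dw` along the curve `w = u cot u + i u`. -/
def hankelKernel (t s u : ℝ) : ℝ :=
  hankelWeight t s u *
    (cos ((t - s) * u) + sin ((t - s) * u) * (1 / u - cos u / sin u))

def hankelIntegral (t s : ℝ) : ℝ := ∫ u in Set.Ioo 0 Real.pi, hankelKernel t s u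

section Kernel

open Real

theorem mul_cot_le_one {u : ℝ} (hu : u ∈ Set.Ioo 0 π) : u * (cos u / sin u) ≤ 1 := by
  have hs := sin_pos_of_mem_Ioo hu
  rw [← mul_div_assoc, div_le_one hs]
  rcases lt_or_ge u (π / 2) with h | h
  · have hc : 0 < cos u := cos_pos_of_mem_Ioo ⟨by linarith [hu.1, pi_pos], h⟩
    have := (lt_tan hu.1 h).le
    rwa [tan_eq_sin_div_cos, le_div_iff₀ hc] at this
  · have hc : cos u ≤ 0 := cos_nonpos_of_pi_div_two_le_of_le h (by linarith [hu.2, pi_pos])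
    nlinarith [hu.1]

theorem sin_div_pos {u : ℝ} (hu : u ∈ Set.Ioo 0 π) : 0 < sin u / u :=
  div_pos (sin_pos_of_mem_Ioo hu) hu.1

theorem log_sin_div_nonpos {u : ℝ} (hu : u ∈ Set.Ioo 0 π) : log (sin u / u) ≤ 0 :=
  log_nonpos (sin_div_pos hu).le ((div_le_one hu.1).2 (sin_le hu.1.le))

theorem hankelWeight_pos (t s u : ℝ) : 0 < hankelWeight t s u := exp_pos _

theorem hankelWeight_eq {t s u : ℝ} (hu : u ∈ Set.Ioo 0 π) :
    hankelWeight t s u = exp (t * (u * (cos u / sin u))) * (sin u / u) ^ s := by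
  rw [hankelWeight, exp_add, rpow_def_of_pos (sin_div_pos hu), mul_comm s]

theorem hankelWeight_le {t s u : ℝ} (ht : 0 ≤ t) (hs : 0 ≤ s) (hu : u ∈ Set.Ioo 0 π) :
    hankelWeight t s u ≤ exp t := by
  have h1 := mul_le_mul_of_nonneg_left (mul_cot_le_one hu) ht
  have h2 := mul_nonpos_of_nonneg_of_nonpos hs (log_sin_div_nonpos hu)
  exact exp_le_exp.2 (by linarith)

theorem hankelWeight_mul_le {t s u : ℝ} (ht : 0 < t) (hs : 0 ≤ s) (hu : u ∈ Set.Ioo 0 π) :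
    hankelWeight t s u * (1 - u * (cos u / sin u)) ≤ exp t / t := by
  have h2 := mul_nonpos_of_nonneg_of_nonpos hs (log_sin_div_nonpos hu)
  set c := u * (cos u / sin u) with hc
  have hc1 : c ≤ 1 := mul_cot_le_one hu
  have h3 : hankelWeight t s u ≤ exp t * exp (-(t * (1 - c))) := by
    rw [← exp_add]
    exact exp_le_exp.2 (by rw [← hc]; linarith)
  have h4 : t * (1 - c) ≤ exp (t * (1 - c)) := by linarith [add_one_le_exp (t * (1 - c))]
  have h5 : exp (-(t * (1 - c))) * (t * (1 - c)) ≤ 1 := by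
    rw [exp_neg, inv_mul_le_iff₀ (exp_pos _)]
    simpa using h4
  rw [le_div_iff₀ ht]
  calc _ ≤ exp t * exp (-(t * (1 - c))) * (1 - c) * t := by
        have : 0 ≤ 1 - c := by linarith
        gcongr
    _ = exp t * (exp (-(t * (1 - c))) * (t * (1 - c))) := by ring
    _ ≤ exp t * 1 := by gcongr
    _ = exp t := mul_one _

theorem abs_hankelKernel_le {t s u : ℝ} (ht : 0 < t) (hs : 0 ≤ s) (hu : u ∈ Set.Ioo 0 π) :
    |hankelKernel t s u| ≤ exp t * (1 + |t - s| / t) := by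
  have hc1 := mul_cot_le_one hu
  have hb : 1 / u - cos u / sin u = (1 - u * (cos u / sin u)) / u := by
    field_simp [hu.1.ne']
  have hW := hankelWeight_pos t s u
  have hsin : |sin ((t - s) * u)| ≤ |t - s| * u := by
    simpa [abs_mul, abs_of_pos hu.1] using abs_sin_le_abs (x := (t - s) * u)
  have h0 : 0 ≤ 1 - u * (cos u / sin u) := by linarith
  rw [hankelKernel, hb, abs_mul, abs_of_pos hW]
  calc _ ≤ hankelWeight t s u * (1 + |t - s| * u * ((1 - u * (cos u / sin u)) / u)) := by
        gcongr
        refine (abs_add_le _ _).trans (add_le_add (abs_cos_le_one _) ?_)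
        rw [abs_mul, abs_of_nonneg (div_nonneg h0 hu.1.le)]
        have := hu.1
        gcongr
    _ = hankelWeight t s u + |t - s| * (hankelWeight t s u * (1 - u * (cos u / sin u))) := by
        field_simp [hu.1.ne']
    _ ≤ exp t + |t - s| * (exp t / t) := by
        gcongr
        · exact hankelWeight_le ht.le hs hu
        · exact hankelWeight_mul_le ht hs hu
    _ = _ := by ring

theorem measurable_hankelKernel (t s : ℝ) : Measurable (hankelKernel t s) := by
  unfold hankelKernel hankelWeight
  fun_prop

theorem integrableOn_hankelKernel {t s : ℝ} (ht : 0 < t) (hs : 0 ≤ s) :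
    IntegrableOn (hankelKernel t s) (Set.Ioo 0 π) :=
  Measure.integrableOn_of_bounded (M := exp t * (1 + |t - s| / t)) (by simp)
    (measurable_hankelKernel t s).aestronglyMeasurable
    ((ae_restrict_iff' measurableSet_Ioo).2 (ae_of_all _ fun _ hu => abs_hankelKernel_le ht hs hu))

theorem hankelWeight_sub_one {t s u : ℝ} (hu : u ∈ Set.Ioo 0 π) :
    hankelWeight t (s - 1) u * (sin u / u) = hankelWeight t s u := by
  conv_lhs => rw [← exp_log (sin_div_pos hu)]
  rw [hankelWeight, hankelWeight, ← exp_add]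
  congr 1
  ring

theorem hankelKernel_sub_one {t s u : ℝ} (hu : u ∈ Set.Ioo 0 π) :
    hankelKernel t (s - 1) u = hankelWeight t s u * (cos ((t - s) * u) +
      sin ((t - s) * u) * (u * (cos u / sin u) * (1 / u - cos u / sin u) - u)) := by
  have hs := (sin_pos_of_mem_Ioo hu).ne'
  have hu0 := hu.1.ne'
  rw [hankelKernel, ← hankelWeight_sub_one (s := s) hu, mul_assoc,
    show (t - (s - 1)) * u = (t - s) * u + u by ring, cos_add, sin_add]
  congr 1
  field_simp
  ring

theorem hasDerivAt_hankelKernel {t s u : ℝ} (hu : u ∈ Set.Ioo 0 π) :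
    HasDerivAt (fun t => hankelKernel t s u) (hankelKernel t (s - 1) u) t := by
  have hs := (sin_pos_of_mem_Ioo hu).ne'
  have hu0 := hu.1.ne'
  have h1 : HasDerivAt (fun t => hankelWeight t s u)
      (hankelWeight t s u * (1 * (u * (cos u / sin u)))) t :=
    (((hasDerivAt_id t).mul_const _).add_const _).exp
  have h2 : HasDerivAt (fun t : ℝ => (t - s) * u) (1 * u) t :=
    ((hasDerivAt_id t).sub_const s).mul_const u
  refine (h1.mul (h2.cos.add (h2.sin.mul_const (1 / u - cos u / sin u)))).congr_deriv ?_
  rw [hankelKernel_sub_one hu]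
  simp only [Pi.add_apply]
  field_simp
  ring

theorem hasDerivAt_hankelWeight {t s u : ℝ} (hu : u ∈ Set.Ioo 0 π) :
    HasDerivAt (hankelWeight t s) (hankelWeight t s u *
      (t * (u * (cos u / sin u) * (1 / u - cos u / sin u) - u) -
        s * (1 / u - cos u / sin u))) u := by
  have hs := (sin_pos_of_mem_Ioo hu).ne'
  have hu0 := hu.1.ne'
  have h1 := (hasDerivAt_id u).mul ((hasDerivAt_cos u).div (hasDerivAt_sin u) hs)
  have h2 := (((hasDerivAt_sin u).div (hasDerivAt_id u) hu0)).log (sin_div_pos hu).ne'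
  refine (((h1.const_mul t).add (h2.const_mul s)).exp).congr_deriv ?_
  simp only [hankelWeight, id, Pi.add_apply, Pi.mul_apply, Pi.div_apply]
  congr 1
  field_simp
  ring

theorem hasDerivAt_hankelWeight_mul_sin {t s u : ℝ} (hu : u ∈ Set.Ioo 0 π) :
    HasDerivAt (fun u => hankelWeight t s u * sin ((t - s) * u))
      (t * hankelKernel t (s - 1) u - s * hankelKernel t s u) u := by
  have h2 : HasDerivAt (fun u : ℝ => (t - s) * u) ((t - s) * 1) u :=
    (hasDerivAt_id u).const_mul (t - s)
  refine ((hasDerivAt_hankelWeight hu).mul h2.sin).congr_deriv ?_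
  rw [hankelKernel_sub_one hu, hankelKernel]
  ring

theorem tendsto_hankelWeight_mul_sin_zero {t s : ℝ} (ht : 0 < t) (hs : 0 ≤ s) :
    Tendsto (fun u => hankelWeight t s u * sin ((t - s) * u)) (𝓝[>] 0) (𝓝 0) := by
  have h : Tendsto (fun u : ℝ => exp t * |sin ((t - s) * u)|) (𝓝[>] 0) (𝓝 0) := by
    have : Continuous fun u : ℝ => exp t * |sin ((t - s) * u)| := by fun_prop
    simpa using (this.tendsto 0).mono_left nhdsWithin_le_nhds
  refine squeeze_zero_norm' ?_ h
  filter_upwards [Ioo_mem_nhdsGT pi_pos] with u hu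
  rw [norm_mul, norm_eq_abs, norm_eq_abs, abs_of_pos (hankelWeight_pos t s u)]
  gcongr
  exact hankelWeight_le ht.le hs hu

theorem tendsto_hankelWeight_mul_sin_pi {t s : ℝ} (ht : 0 < t) (hs : 0 < s) :
    Tendsto (fun u => hankelWeight t s u * sin ((t - s) * u)) (𝓝[<] π) (𝓝 0) := by
  have h : Tendsto (fun u : ℝ => exp t * (sin u / u) ^ s) (𝓝[<] π) (𝓝 0) := by
    have : ContinuousAt (fun u : ℝ => exp t * (sin u / u) ^ s) π := by
      refine continuousAt_const.mul (ContinuousAt.rpow_const ?_ (Or.inr hs.le))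
      exact continuous_sin.continuousAt.div continuousAt_id pi_ne_zero
    have h := this.tendsto
    simp only [sin_pi, zero_div, zero_rpow hs.ne', mul_zero] at h
    exact h.mono_left nhdsWithin_le_nhds
  refine squeeze_zero_norm' ?_ h
  filter_upwards [Ioo_mem_nhdsLT pi_pos] with u hu
  rw [norm_mul, norm_eq_abs, norm_eq_abs, abs_of_pos (hankelWeight_pos t s u), hankelWeight_eq hu]
  have h1 := mul_le_mul_of_nonneg_left (mul_cot_le_one hu) ht.le
  have h2 : (0:ℝ) ≤ (sin u / u) ^ s := (rpow_pos_of_pos (sin_div_pos hu) s).le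
  calc _ ≤ exp (t * (u * (cos u / sin u))) * (sin u / u) ^ s * 1 := by
        gcongr
        exact abs_sin_le_one _
    _ ≤ _ := by
        rw [mul_one]
        gcongr
        linarith

theorem mul_hankelIntegral_sub_one {t s : ℝ} (ht : 0 < t) (hs : 1 ≤ s) :
    t * hankelIntegral t (s - 1) = s * hankelIntegral t s := by
  have i1 := (integrableOn_hankelKernel ht (sub_nonneg.2 hs)).const_mul t
  have i2 := (integrableOn_hankelKernel ht (s := s) (by linarith)).const_mul s
  have h := intervalIntegral.integral_eq_sub_of_hasDerivAt_of_tendsto pi_pos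
    (fun u hu => hasDerivAt_hankelWeight_mul_sin (t := t) (s := s) hu)
    ((intervalIntegrable_iff_integrableOn_Ioo_of_le pi_pos.le).2 (i1.sub i2))
    (tendsto_hankelWeight_mul_sin_zero ht (by linarith))
    (tendsto_hankelWeight_mul_sin_pi ht (by linarith))
  rw [intervalIntegral.integral_of_le pi_pos.le, integral_Ioc_eq_integral_Ioo,
    integral_sub i1 i2, integral_const_mul, integral_const_mul] at h
  simp only [hankelIntegral]
  linarith

theorem hasDerivAt_hankelIntegral {t s : ℝ} (ht : 0 < t) (hs : 1 ≤ s) :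
    HasDerivAt (fun t => hankelIntegral t s) (hankelIntegral t (s - 1)) t := by
  refine (hasDerivAt_integral_of_dominated_loc_of_deriv_le
    (F' := fun t u => hankelKernel t (s - 1) u)
    (bound := fun _ => exp (2 * t) * (1 + (2 * t + s) / (t / 2)))
    (Ioo_mem_nhds (show t / 2 < t by linarith) (show t < 2 * t by linarith))
    (Eventually.of_forall fun t => (measurable_hankelKernel t s).aestronglyMeasurable)
    (integrableOn_hankelKernel ht (by linarith))
    (measurable_hankelKernel t (s - 1)).aestronglyMeasurable ?_ ?_ ?_).2
  · refine (ae_restrict_iff' measurableSet_Ioo).2 (ae_of_all _ fun u hu x hx => ?_)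
    have hx0 : 0 < x := by linarith [hx.1]
    refine (abs_hankelKernel_le hx0 (sub_nonneg.2 hs) hu).trans ?_
    have : |x - (s - 1)| ≤ 2 * t + s := abs_le.2 ⟨by linarith, by linarith [hx.2]⟩
    gcongr
    · exact hx.2.le
    · exact hx.1.le
  · exact integrableOn_const (by simp)
  · exact (ae_restrict_iff' measurableSet_Ioo).2
      (ae_of_all _ fun u hu x _ => hasDerivAt_hankelKernel hu)

theorem hankelIntegral_eq_rpow_mul_of_one_le {t s : ℝ} (ht : 0 < t) (hs : 1 ≤ s) :
    hankelIntegral t s = t ^ s * hankelIntegral 1 s := by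
  have hd : ∀ x ∈ Set.Ioi (0:ℝ), HasDerivAt (fun t => hankelIntegral t s * t ^ (-s)) 0 x := by
    intro x hx
    have hx : 0 < x := hx
    refine ((hasDerivAt_hankelIntegral hx hs).mul
      (hasDerivAt_rpow_const (p := -s) (Or.inl hx.ne'))).congr_deriv ?_
    rw [rpow_sub_one hx.ne']
    field_simp
    linear_combination x ^ (-s) * mul_hankelIntegral_sub_one hx hs
  have h := isOpen_Ioi.is_const_of_deriv_eq_zero isPreconnected_Ioi
    (fun x hx => (hd x hx).differentiableAt.differentiableWithinAt)
    (fun x hx => (hd x hx).deriv) ht (Set.mem_Ioi.2 one_pos)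
  simp only [one_rpow, mul_one] at h
  rw [← h, rpow_neg ht.le]
  field_simp [(rpow_pos_of_pos ht s).ne']

theorem mul_hankelIntegral {t s : ℝ} (ht : 0 < t) (hs : 0 ≤ s) :
    t * hankelIntegral t s = (s + 1) * hankelIntegral t (s + 1) := by
  have := mul_hankelIntegral_sub_one ht (s := s + 1) (by linarith)
  simpa using this

theorem hankelIntegral_eq_rpow_mul {t s : ℝ} (ht : 0 < t) (hs : 0 ≤ s) :
    hankelIntegral t s = t ^ s * hankelIntegral 1 s := by
  have h1 := mul_hankelIntegral ht hs
  have h2 := mul_hankelIntegral one_pos hs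
  rw [hankelIntegral_eq_rpow_mul_of_one_le ht (s := s + 1) (by linarith), rpow_add_one ht.ne'] at h1
  refine mul_left_cancel₀ ht.ne' ?_
  linear_combination h1 - t * t ^ s * h2
theorem hankelIntegral_self (s : ℝ) :
    hankelIntegral s s = ∫ u in Set.Ioo 0 π, hankelWeight s s u := by
  simp [hankelIntegral, hankelKernel]

theorem integrableOn_hankelWeight_self {s : ℝ} (hs : 0 < s) :
    IntegrableOn (hankelWeight s s) (Set.Ioo 0 π) := by
  have h := integrableOn_hankelKernel hs hs.le
  have e : hankelKernel s s = hankelWeight s s := by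
    ext u
    simp [hankelKernel]
  rwa [e] at h

theorem hankelIntegral_self_pos {s : ℝ} (hs : 0 < s) : 0 < hankelIntegral s s := by
  rw [hankelIntegral_self, setIntegral_pos_iff_support_of_nonneg_ae
    (ae_of_all _ fun u => (hankelWeight_pos s s u).le) (integrableOn_hankelWeight_self hs)]
  have : Function.support (hankelWeight s s) = Set.univ :=
    Set.eq_univ_of_forall fun u => (hankelWeight_pos s s u).ne'
  simp [this, pi_pos]

theorem hankelIntegral_self_sq_le {x δ : ℝ} (hx : 0 < x) (hδ : 0 < δ) :
    hankelIntegral (x + δ) (x + δ) ^ 2 ≤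
      hankelIntegral x x * hankelIntegral (x + 2 * δ) (x + 2 * δ) := by
  set a := hankelIntegral x x with ha
  set b := hankelIntegral (x + δ) (x + δ) with hb
  set c := hankelIntegral (x + 2 * δ) (x + 2 * δ) with hc
  have ha0 : 0 < a := hankelIntegral_self_pos hx
  have hb0 : 0 < b := hankelIntegral_self_pos (by positivity)
  have i1 := (integrableOn_hankelWeight_self hx).const_mul (b / a)
  have i2 := (integrableOn_hankelWeight_self (s := x + 2 * δ) (by positivity)).const_mul (a / b)
  have i3 := (integrableOn_hankelWeight_self (s := x + δ) (by positivity)).const_mul 2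
  have key : 2 * b ≤ b / a * a + a / b * c := by
    rw [ha, hb, hc, hankelIntegral_self, hankelIntegral_self, hankelIntegral_self,
      ← integral_const_mul, ← integral_const_mul, ← integral_const_mul, ← hankelIntegral_self,
      ← hankelIntegral_self, ← ha, ← hb, ← integral_add i1 i2]
    refine integral_mono i3 (i1.add i2) fun u => ?_
    have e : hankelWeight (x + δ) (x + δ) u ^ 2 =
        hankelWeight x x u * hankelWeight (x + 2 * δ) (x + 2 * δ) u := by
      rw [hankelWeight, hankelWeight, hankelWeight, ← exp_nat_mul, ← exp_add]
      congr 1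
      push_cast
      ring
    have h1 := hankelWeight_pos x x u
    have h2 := hankelWeight_pos (x + δ) (x + δ) u
    have h3 := hankelWeight_pos (x + 2 * δ) (x + 2 * δ) u
    have hsq : (2 * hankelWeight (x + δ) (x + δ) u) ^ 2 ≤
        (b / a * hankelWeight x x u + a / b * hankelWeight (x + 2 * δ) (x + 2 * δ) u) ^ 2 := by
      have : b / a * hankelWeight x x u * (a / b * hankelWeight (x + 2 * δ) (x + 2 * δ) u) =
          hankelWeight (x + δ) (x + δ) u ^ 2 := by
        rw [e]
        field_simp
      nlinarith [sq_nonneg (b / a * hankelWeight x x u -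
        a / b * hankelWeight (x + 2 * δ) (x + 2 * δ) u)]
    exact (sq_le_sq₀ (by positivity) (by positivity)).1 hsq
  rw [div_mul_cancel₀ _ ha0.ne', div_mul_eq_mul_div] at key
  have : b ≤ a * c / b := by linarith
  rw [le_div_iff₀ hb0] at this
  linarith

theorem rpow_self_mul_rpow_self_le {x δ : ℝ} (hx : 0 < x) (hδ : 0 < δ) :
    x ^ x * (x + 2 * δ) ^ (x + 2 * δ) ≤
      ((x + δ) ^ (x + δ)) ^ 2 * exp (2 * δ ^ 2 / (x + δ)) := by
  have h1 : 0 < x + δ := by positivity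
  have h2 : 0 < x + 2 * δ := by positivity
  rw [rpow_def_of_pos hx, rpow_def_of_pos h1, rpow_def_of_pos h2, ← exp_nat_mul, ← exp_add,
    ← exp_add, exp_le_exp]
  have l1 := log_le_sub_one_of_pos (div_pos hx h1)
  have l2 := log_le_sub_one_of_pos (div_pos h2 h1)
  rw [log_div hx.ne' h1.ne'] at l1
  rw [log_div h2.ne' h1.ne'] at l2
  have m1 := mul_le_mul_of_nonneg_left l1 hx.le
  have m2 := mul_le_mul_of_nonneg_left l2 h2.le
  have e : x * (x / (x + δ) - 1) + (x + 2 * δ) * ((x + 2 * δ) / (x + δ) - 1) =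
      2 * δ ^ 2 / (x + δ) := by
    field_simp
    ring
  push_cast
  linarith

theorem Gamma_midpoint_sq_le {x y : ℝ} (hx : 0 < x) (hy : 0 < y) :
    Gamma ((x + y) / 2) ^ 2 ≤ Gamma x * Gamma y := by
  have h := Gamma_mul_add_mul_le_rpow_Gamma_mul_rpow_Gamma hx hy (a := 1 / 2) (b := 1 / 2)
    (by norm_num) (by norm_num) (by norm_num)
  rw [← sqrt_eq_rpow, ← sqrt_eq_rpow, show 1 / 2 * x + 1 / 2 * y = (x + y) / 2 by ring] at h
  have h0 := Gamma_pos_of_pos (show 0 < (x + y) / 2 by positivity)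
  calc _ ≤ (√(Gamma x) * √(Gamma y)) ^ 2 := by gcongr
    _ = _ := by
      rw [mul_pow, sq_sqrt (Gamma_pos_of_pos hx).le, sq_sqrt (Gamma_pos_of_pos hy).le]

theorem eq_of_periodic_of_sq_le {a : ℕ → ℝ} {m : ℕ} (hm : 0 < m) (hpos : ∀ k, 0 < a k)
    (hper : ∀ k, a (k + m) = a k) (hsq : ∀ k, a (k + 1) ^ 2 ≤ a k * a (k + 2)) (k : ℕ) :
    a k = a 0 := by
  by_cases h : ∃ n, a n ≤ a (n + 1)
  · obtain ⟨n, hn⟩ := h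
    have hmono : ∀ j, a (n + j) ≤ a (n + (j + 1)) := by
      intro j
      induction j with
      | zero => exact hn
      | succ j ih =>
        have h1 := hsq (n + j)
        have h2 := hpos (n + (j + 1))
        have h3 := hpos (n + (j + 2))
        rw [sq] at h1
        refine le_of_mul_le_mul_left (h1.trans ?_) h2
        exact mul_le_mul_of_nonneg_right ih h3.le
    have hM : Monotone fun j => a (n + j) := monotone_nat_of_le_succ hmono
    have hmul : ∀ i j, a (i + j * m) = a i := by
      intro i j
      induction j with
      | zero => simp
      | succ j ih => rw [Nat.succ_mul, ← add_assoc, hper, ih]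
    have hle : ∀ i j, a i ≤ a j := by
      intro i j
      have hnm : n ≤ n * m := Nat.le_mul_of_pos_right n hm
      have hlarge : i + n * m ≤ j + (n + i + n) * m := by
        have : i ≤ i * m := Nat.le_mul_of_pos_right i hm
        rw [add_mul, add_mul]
        lia
      have := hM (show i + n * m - n ≤ j + (n + i + n) * m - n by lia)
      simp only at this
      rwa [show n + (i + n * m - n) = i + n * m by lia,
        show n + (j + (n + i + n) * m - n) = j + (n + i + n) * m by
          have := Nat.le_mul_of_pos_right (n + i + n) hm
          lia, hmul, hmul] at this
    exact le_antisymm (hle _ _) (hle _ _)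
  · push Not at h
    have hA : StrictAnti a := strictAnti_nat_of_succ_lt h
    have := hA (show 0 < 0 + m by lia)
    rw [hper] at this
    exact absurd this (lt_irrefl _)

/-- The normalised integral, which turns out to be the constant `π`. -/
def hankelRatio (s : ℝ) : ℝ := hankelIntegral 1 s * Gamma (s + 1)

theorem hankelIntegral_self_eq {s : ℝ} (hs : 0 < s) :
    hankelIntegral s s = s ^ s * hankelIntegral 1 s := hankelIntegral_eq_rpow_mul hs hs.le

theorem hankelIntegral_one_pos {s : ℝ} (hs : 0 < s) : 0 < hankelIntegral 1 s := by
  have h := hankelIntegral_self_pos hs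
  rw [hankelIntegral_self_eq hs] at h
  exact pos_of_mul_pos_right h (rpow_pos_of_pos hs s).le

theorem hankelRatio_pos {s : ℝ} (hs : 0 < s) : 0 < hankelRatio s :=
  mul_pos (hankelIntegral_one_pos hs) (Gamma_pos_of_pos (by positivity))

theorem hankelRatio_add_one {s : ℝ} (hs : 0 < s) : hankelRatio (s + 1) = hankelRatio s := by
  have h := mul_hankelIntegral one_pos hs.le
  rw [hankelRatio, hankelRatio, Gamma_add_one (by positivity : s + 1 ≠ 0)]
  linear_combination -Gamma (s + 1) * h

theorem hankelRatio_add_nat {s : ℝ} (hs : 0 < s) (n : ℕ) :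
    hankelRatio (s + n) = hankelRatio s := by
  induction n with
  | zero => simp
  | succ n ih => rw [Nat.cast_succ, ← add_assoc, hankelRatio_add_one (by positivity), ih]

theorem hankelRatio_sq_le_mul_exp {x δ : ℝ} (hx : 0 < x) (hδ : 0 < δ) :
    hankelRatio (x + δ) ^ 2 ≤
      hankelRatio x * hankelRatio (x + 2 * δ) * exp (2 * δ ^ 2 / (x + δ)) := by
  have h1 : 0 < x + δ := by positivity
  have h2 : 0 < x + 2 * δ := by positivity
  have hI := hankelIntegral_self_sq_le hx hδ
  have hp := rpow_self_mul_rpow_self_le hx hδ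
  have hG := Gamma_midpoint_sq_le (show 0 < x + 1 by positivity)
    (show 0 < x + 2 * δ + 1 by positivity)
  rw [show (x + 1 + (x + 2 * δ + 1)) / 2 = x + δ + 1 by ring] at hG
  rw [hankelIntegral_self_eq hx, hankelIntegral_self_eq h1, hankelIntegral_self_eq h2] at hI
  have k0 := hankelIntegral_one_pos hx
  have k2 := hankelIntegral_one_pos h2
  have hQ := rpow_pos_of_pos h1 (x + δ)
  have hK : hankelIntegral 1 (x + δ) ^ 2 ≤
      hankelIntegral 1 x * hankelIntegral 1 (x + 2 * δ) * exp (2 * δ ^ 2 / (x + δ)) := by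
    refine le_of_mul_le_mul_left ?_ (pow_pos hQ 2)
    have := mul_le_mul_of_nonneg_right hp (mul_pos k0 k2).le
    linarith
  simp only [hankelRatio, mul_pow]
  calc _ ≤ hankelIntegral 1 x * hankelIntegral 1 (x + 2 * δ) * exp (2 * δ ^ 2 / (x + δ)) *
        (Gamma (x + 1) * Gamma (x + 2 * δ + 1)) := by gcongr
    _ = _ := by ring

theorem hankelRatio_sq_le {x δ : ℝ} (hx : 0 < x) (hδ : 0 < δ) :
    hankelRatio (x + δ) ^ 2 ≤ hankelRatio x * hankelRatio (x + 2 * δ) := by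
  have hlim : Tendsto (fun n : ℕ => hankelRatio x * hankelRatio (x + 2 * δ) *
      exp (2 * δ ^ 2 / ((n : ℝ) + (x + δ)))) atTop
      (𝓝 (hankelRatio x * hankelRatio (x + 2 * δ) * exp 0)) := by
    refine ((continuous_exp.tendsto 0).comp ?_).const_mul _
    exact (tendsto_atTop_add_const_right _ _ tendsto_natCast_atTop_atTop).const_div_atTop _
  rw [exp_zero, mul_one] at hlim
  refine ge_of_tendsto hlim (Eventually.of_forall fun n => ?_)
  have h := hankelRatio_sq_le_mul_exp (x := x + n) (δ := δ) (by positivity) hδ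
  rwa [show x + n + δ = x + δ + n by ring, show x + n + 2 * δ = x + 2 * δ + n by ring,
    hankelRatio_add_nat hx, hankelRatio_add_nat (by positivity),
    hankelRatio_add_nat (by positivity), show x + δ + n = n + (x + δ) by ring] at h

theorem hankelRatio_div_eq {m : ℕ} (hm : 0 < m) (k : ℕ) :
    hankelRatio ((k + 1) / m) = hankelRatio (1 / m) := by
  have hm' : (0:ℝ) < m := by exact_mod_cast hm
  have h := eq_of_periodic_of_sq_le (a := fun k : ℕ => hankelRatio ((k + 1) / m)) hm
    (fun k => hankelRatio_pos (by positivity)) (fun k => ?_) (fun k => ?_) k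
  · simpa using h
  · push_cast
    rw [show ((k : ℝ) + m + 1) / m = (k + 1) / m + 1 by field_simp; ring,
      hankelRatio_add_one (by positivity)]
  · have := hankelRatio_sq_le (x := ((k : ℝ) + 1) / m) (δ := 1 / m) (by positivity) (by positivity)
    push_cast
    convert this using 3 <;> field_simp <;> ring

theorem tendsto_hankelIntegral_self :
    Tendsto (fun s => hankelIntegral s s) (𝓝[>] 0) (𝓝 π) := by
  simp only [hankelIntegral_self]
  have h : Tendsto (fun s => ∫ u in Set.Ioo 0 π, hankelWeight s s u) (𝓝[>] 0)
      (𝓝 (∫ _ in Set.Ioo 0 π, (1:ℝ))) := by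
    refine tendsto_integral_filter_of_dominated_convergence (fun _ => exp 1) ?_ ?_
      (integrableOn_const (by simp)) ?_
    · refine Eventually.of_forall fun s => Measurable.aestronglyMeasurable ?_
      unfold hankelWeight
      fun_prop
    · filter_upwards [Ioo_mem_nhdsGT one_pos] with s hs
      refine (ae_restrict_iff' measurableSet_Ioo).2 (ae_of_all _ fun u hu => ?_)
      rw [norm_eq_abs, abs_of_pos (hankelWeight_pos s s u)]
      exact (hankelWeight_le hs.1.le hs.1.le hu).trans (exp_le_exp.2 hs.2.le)
    · refine ae_of_all _ fun u => Tendsto.mono_left ?_ nhdsWithin_le_nhds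
      have : Continuous fun s => hankelWeight s s u := by
        unfold hankelWeight
        fun_prop
      simpa [hankelWeight] using this.tendsto 0
  simpa [pi_pos.le] using h

theorem tendsto_hankelRatio : Tendsto hankelRatio (𝓝[>] 0) (𝓝 π) := by
  have h1 : Tendsto (fun s : ℝ => exp (-(s * log s))) (𝓝[>] 0) (𝓝 1) := by
    have : Continuous fun s : ℝ => exp (-(s * log s)) := by
      have := continuous_mul_log
      fun_prop
    simpa using (this.tendsto 0).mono_left nhdsWithin_le_nhds
  have h2 : Tendsto (fun s : ℝ => Gamma (s + 1)) (𝓝[>] 0) (𝓝 1) := by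
    have hG : ContinuousAt Gamma (0 + 1) := by
      refine (differentiableAt_Gamma fun m => ?_).continuousAt
      have : (0:ℝ) ≤ m := m.cast_nonneg
      linarith
    have : ContinuousAt (fun s : ℝ => Gamma (s + 1)) 0 :=
      ContinuousAt.comp (f := fun s : ℝ => s + 1) hG (by fun_prop)
    simpa using this.tendsto.mono_left nhdsWithin_le_nhds
  have h := (tendsto_hankelIntegral_self.mul h1).mul h2
  rw [mul_one, mul_one] at h
  refine h.congr' ?_
  filter_upwards [self_mem_nhdsWithin] with s hs
  have hs : 0 < s := hs
  rw [hankelIntegral_self_eq hs, hankelRatio, rpow_def_of_pos hs, exp_neg, mul_comm s]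
  field_simp

theorem hankelRatio_eq_pi {p q : ℕ} (hp : 0 < p) (hq : 0 < q) : hankelRatio (p / q) = π := by
  have hq' : (0:ℝ) < q := by exact_mod_cast hq
  have hlim : Tendsto (fun n : ℕ => hankelRatio (1 / ((q * (n + 1) : ℕ) : ℝ))) atTop (𝓝 π) := by
    refine tendsto_hankelRatio.comp (tendsto_nhdsWithin_iff.2 ⟨?_, ?_⟩)
    · refine tendsto_const_nhds.div_atTop (tendsto_natCast_atTop_atTop.comp ?_)
      exact (tendsto_add_atTop_nat 1).const_mul_atTop' hq
    · exact Eventually.of_forall fun n => Set.mem_Ioi.2 (by positivity)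
  refine tendsto_nhds_unique (tendsto_const_nhds.congr fun n => ?_) hlim
  obtain ⟨k, hk⟩ := Nat.exists_eq_add_one.2 (show 0 < p * (n + 1) by positivity)
  rw [← hankelRatio_div_eq (by positivity) k]
  have hk' : (p : ℝ) * (n + 1) = k + 1 := by exact_mod_cast hk
  rw [← hk']
  congr 1
  push_cast
  field_simp

theorem integral_hankelWeight_self {p q : ℕ} (hp : 0 < p) (hq : 0 < q) {s : ℝ} (hs : s = p / q) :
    ∫ u in Set.Ioo 0 π, hankelWeight s s u = π * s ^ s / Gamma (s + 1) := by
  have hs0 : 0 < s := by rw [hs]; positivity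
  have h := hankelRatio_eq_pi hp hq
  have hG := Gamma_pos_of_pos (show 0 < s + 1 by positivity)
  rw [← hs, hankelRatio] at h
  rw [← hankelIntegral_self, hankelIntegral_self_eq hs0, ← h]
  field_simp

theorem exp_mul_sincR_rpow {s u : ℝ} (hu : u ∈ Set.Ioo 0 π) :
    (exp (u * (cos u / sin u)) * sincR u) ^ s = hankelWeight s s u := by
  rw [sincR, if_neg hu.1.ne', mul_rpow (exp_pos _).le (sin_div_pos hu).le, ← exp_mul,
    hankelWeight_eq hu, mul_comm s]

theorem sincR_neg (u : ℝ) : sincR (-u) = sincR u := by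
  simp [sincR, neg_div_neg_eq]

theorem sincR_nonneg {u : ℝ} (hu : u ∈ Set.Ioo (-π) π) : 0 ≤ sincR u := by
  have pos : ∀ v ∈ Set.Ioo 0 π, 0 ≤ sincR v := fun v hv => by
    rw [sincR, if_neg hv.1.ne']
    exact (sin_div_pos hv).le
  rcases lt_trichotomy u 0 with h | h | h
  · rw [← sincR_neg]
    exact pos _ ⟨by linarith, by linarith [hu.1]⟩
  · simp [sincR, h]
  · exact pos _ ⟨h, hu.2⟩

theorem setIntegral_Ioo_neg_of_even {f : ℝ → ℝ} (hf : ∀ u, f (-u) = f u) (b : ℝ) :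
    ∫ u in Set.Ioo (-b) b, f u = 2 * ∫ u in Set.Ioo 0 b, f u := by
  have h := integral_comp_abs (f := (Set.Iio b).indicator f)
  have e : (fun x : ℝ => (Set.Iio b).indicator f |x|) = (Set.Ioo (-b) b).indicator f := by
    ext x
    have : f |x| = f x := by rcases abs_choice x with h | h <;> simp [h, hf]
    simp only [Set.indicator, Set.mem_Iio, Set.mem_Ioo, abs_lt, this]
  rw [e, integral_indicator measurableSet_Ioo, setIntegral_indicator measurableSet_Iio] at h
  rw [h, Set.Ioi_inter_Iio]

end Kernel

/-- For `d ≥ 3`, `η_d` is a probability density on `(−π,π)`: it is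
nonnegative, and `∫_{−π}^{π} (exp(u cot u) sinc u)^{d/2} du = 2π (d/2)^{d/2} / Γ(d/2+1)`. -/
theorem etaDen_is_probability_density (d : ℕ) (hd : 3 ≤ d) :
    (∀ u : ℝ, 0 ≤ etaDen d u) ∧
    (∫ u in Set.Ioo (-Real.pi) Real.pi,
        (Real.exp (u * (Real.cos u / Real.sin u)) * sincR u) ^ ((d : ℝ) / 2)) =
      2 * Real.pi * ((d : ℝ) / 2) ^ ((d : ℝ) / 2) / Real.Gamma ((d : ℝ) / 2 + 1) := by
  refine ⟨fun u => ?_, ?_⟩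
  · refine Set.indicator_nonneg (fun v hv => ?_) u
    have hs := sincR_nonneg hv
    have hG := Real.Gamma_pos_of_pos (show 0 < (d : ℝ) / 2 + 1 by positivity)
    positivity
  · have h := integral_hankelWeight_self (p := d) (q := 2) (by lia) two_pos
      (s := (d : ℝ) / 2) (by norm_num)
    rw [setIntegral_Ioo_neg_of_even (fun u => by simp [sincR_neg, div_neg]),
      setIntegral_congr_fun measurableSet_Ioo (fun u hu => exp_mul_sincR_rpow hu), h]
    ring

end
end

section
/- Let d > 0 and t > 0 be real numbers and set a := d·t². Then there exists an even, continuously differentiable function y : ℝ → ℝ such that for all x > 0: y′(x) = −tan(a·x·(1 − y(x)) + arctan(x/y(x))), y′(x) ≤ 0, and 1 ≤ y(x) ≤ 1 + arctan(x/y(x))/(a·x) ≤ 1 + 1/a. Moreover, with γ(x) := d·t·(x − i·y(x)), the quantity exp(−γ(x)²/(2d)) · e^{−i·t·γ(x)} · γ′(x)/(2πi·γ(x)) is a nonnegative real number for every x ∈ ℝ. -/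
open MeasureTheory Filter Topology

noncomputable section

namespace SteepestDescent

/-- The argument of `-i γ' / γ` compensated by the phase of the exponential factors. -/
def phase (a x y : ℝ) : ℝ := a * x * (1 - y) + Real.arctan (x / y)

/-- The modulus of `integrand a (y + i x)`. -/
def amplitude (a x y : ℝ) : ℝ :=
  Real.exp (a / 2 * (y ^ 2 - x ^ 2) - a * y) / (y * √(1 + (x / y) ^ 2))

/-- The integrand in the rotated coordinate `w = y + i x`. -/
def integrand (a : ℝ) (w : ℂ) : ℂ := Complex.exp (a / 2 * w ^ 2 - a * w) / w

lemma amplitude_pos (a x : ℝ) {y : ℝ} (hy : 0 < y) : 0 < amplitude a x y := by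
  unfold amplitude; positivity

lemma phase_neg (a x y : ℝ) : phase a (-x) y = -phase a x y := by
  unfold phase
  rw [neg_div, Real.arctan_neg]
  ring

lemma amplitude_neg (a x y : ℝ) : amplitude a (-x) y = amplitude a x y := by
  unfold amplitude
  rw [neg_div, neg_sq, neg_sq]

lemma phase_anti (a : ℝ) (ha : 0 < a) {x y z : ℝ} (hx : 0 ≤ x) (hy : 0 < y) (hyz : y ≤ z) :
    phase a x z ≤ phase a x y := by
  unfold phase
  have h1 : x / z ≤ x / y := div_le_div_of_nonneg_left hx hy hyz
  have h2 := Real.arctan_mono h1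
  have h3 : a * x * (1 - z) ≤ a * x * (1 - y) :=
    mul_le_mul_of_nonneg_left (by linarith) (by positivity)
  linarith

lemma continuousAt_phase (a : ℝ) (p : ℝ × ℝ) (hp : 0 < p.2) :
    ContinuousAt (fun p : ℝ × ℝ => phase a p.1 p.2) p := by
  unfold phase
  have h : ContinuousAt (fun p : ℝ × ℝ => p.1 / p.2) p :=
    continuousAt_fst.div continuousAt_snd hp.ne'
  have h2 := Real.continuous_arctan.continuousAt.comp h
  exact ContinuousAt.add (by fun_prop) h2

lemma polar_form (x : ℝ) {y : ℝ} (hy : 0 < y) :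
    (y : ℂ) + x * Complex.I =
      ((y * √(1 + (x / y) ^ 2) : ℝ) : ℂ) * Complex.exp (Real.arctan (x / y) * Complex.I) := by
  rw [Complex.exp_mul_I, ← Complex.ofReal_cos, ← Complex.ofReal_sin, Real.cos_arctan,
    Real.sin_arctan]
  have h : √(1 + (x / y) ^ 2) ≠ 0 := by positivity
  apply Complex.ext
  · simp
    field_simp
  · simp
    field_simp

lemma integrand_eq (a x : ℝ) {y : ℝ} (hy : 0 < y) :
    integrand a (y + x * Complex.I) =
      (amplitude a x y : ℂ) * Complex.exp (-(phase a x y : ℂ) * Complex.I) := by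
  have h : ((y * √(1 + (x / y) ^ 2) : ℝ) : ℂ) ≠ 0 := by
    exact_mod_cast (show y * √(1 + (x / y) ^ 2) ≠ 0 by positivity)
  unfold integrand
  have e : (a / 2 * ((y : ℂ) + x * Complex.I) ^ 2 - a * ((y : ℂ) + x * Complex.I)) =
      ((a / 2 * (y ^ 2 - x ^ 2) - a * y : ℝ) : ℂ) + (-(phase a x y : ℂ) * Complex.I) +
        Real.arctan (x / y) * Complex.I := by
    have hI := Complex.I_sq
    unfold phase
    push_cast
    linear_combination (a / 2 * x ^ 2 : ℂ) * hI
  rw [e, Complex.exp_add, Complex.exp_add, polar_form x hy]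
  unfold amplitude
  rw [Complex.ofReal_div, Complex.ofReal_exp]
  have h2 := Complex.exp_ne_zero (Real.arctan (x / y) * Complex.I)
  field_simp

lemma exists_primitive (a : ℝ) :
    ∃ G : ℂ → ℂ, ∀ w : ℂ, 0 < w.re → HasStrictDerivAt G (integrand a w) w := by
  have hopen : IsOpen {w : ℂ | 0 < w.re} := isOpen_lt continuous_const Complex.continuous_re
  have hd : DifferentiableOn ℂ (integrand a) {w : ℂ | 0 < w.re} := by
    intro w hw
    have : w ≠ 0 := by rintro rfl; simp at hw
    unfold integrand
    apply DifferentiableAt.differentiableWithinAt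
    fun_prop (disch := assumption)
  obtain ⟨G, hG⟩ := (convex_halfSpace_re_gt 0).exists_forall_hasDerivWithinAt hd
  have hG' : ∀ w : ℂ, 0 < w.re → HasDerivAt G (integrand a w) w := fun w hw =>
    (hG w hw).hasDerivAt (hopen.mem_nhds hw)
  refine ⟨G, fun w hw => ?_⟩
  have han : AnalyticAt ℂ G w := DifferentiableOn.analyticAt
    (fun z hz => (hG' z hz).differentiableAt.differentiableWithinAt) (hopen.mem_nhds hw)
  have := han.hasStrictDerivAt
  rwa [(hG' w hw).deriv] at this

/-- The differential of the real part of a primitive of the integrand. -/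
def dPotential (a x y : ℝ) : ℝ × ℝ →L[ℝ] ℝ :=
  (amplitude a x y * Real.sin (phase a x y)) • ContinuousLinearMap.fst ℝ ℝ ℝ +
    (amplitude a x y * Real.cos (phase a x y)) • ContinuousLinearMap.snd ℝ ℝ ℝ

/-- `K` is, up to a constant, the real part of a primitive of the integrand. -/
def IsPotential (a : ℝ) (K : ℝ × ℝ → ℝ) : Prop :=
  ∀ x y : ℝ, 0 < y → HasStrictFDerivAt K (dPotential a x y) (x, y)

lemma exists_isPotential (a : ℝ) : ∃ K, IsPotential a K := by
  obtain ⟨G, hG⟩ := exists_primitive a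
  let L : ℝ × ℝ →L[ℝ] ℂ :=
    Complex.ofRealCLM.comp (ContinuousLinearMap.snd ℝ ℝ ℝ) +
      (Complex.I : ℂ) • Complex.ofRealCLM.comp (ContinuousLinearMap.fst ℝ ℝ ℝ)
  have hL : ∀ p, L p = (p.2 : ℂ) + p.1 * Complex.I := fun p => by simp [L, mul_comm]
  refine ⟨fun p => (G (L p)).re, fun x y hy => ?_⟩
  have h1 : HasStrictDerivAt G (integrand a (L (x, y))) (L (x, y)) := by
    apply hG
    rw [hL]; simpa using hy
  have h2 := (h1.hasStrictFDerivAt.restrictScalars ℝ).comp (x, y) L.hasStrictFDerivAt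
  have h3 := Complex.reCLM.hasStrictFDerivAt.comp (x, y) h2
  refine h3.congr_fderiv ?_
  rw [hL, integrand_eq a x hy, ← Complex.ofReal_neg, Complex.exp_mul_I, ← Complex.ofReal_cos,
    ← Complex.ofReal_sin, Real.cos_neg, Real.sin_neg]
  refine ContinuousLinearMap.ext fun p => ?_
  simp [dPotential, hL, Complex.cos_ofReal_re, Complex.sin_ofReal_re]
  ring

namespace IsPotential

variable {a : ℝ} {K : ℝ × ℝ → ℝ}

lemma hasDerivAt_fst (hK : IsPotential a K) (x : ℝ) {y : ℝ} (hy : 0 < y) :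
    HasDerivAt (fun s => K (s, y)) (amplitude a x y * Real.sin (phase a x y)) x := by
  have h := (hK x y hy).hasFDerivAt.comp_hasDerivAt x
    ((hasDerivAt_id x).prodMk (hasDerivAt_const x y))
  simpa [dPotential, Function.comp_def] using h

lemma hasDerivAt_snd (hK : IsPotential a K) (x : ℝ) {y : ℝ} (hy : 0 < y) :
    HasDerivAt (fun s => K (x, s)) (amplitude a x y * Real.cos (phase a x y)) y := by
  have h := (hK x y hy).hasFDerivAt.comp_hasDerivAt y
    ((hasDerivAt_const y x).prodMk (hasDerivAt_id y))
  simpa [dPotential, Function.comp_def] using h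

lemma apply_neg (hK : IsPotential a K) (x : ℝ) {y : ℝ} (hy : 0 < y) : K (-x, y) = K (x, y) := by
  have h : ∀ s : ℝ, HasDerivAt (fun s => K (-s, y) - K (s, y)) 0 s := fun s => by
    have h1 := (hK.hasDerivAt_fst (-s) hy).scomp s (hasDerivAt_neg s)
    refine (h1.sub (hK.hasDerivAt_fst s hy)).congr_deriv ?_
    rw [phase_neg, amplitude_neg, Real.sin_neg]
    simp
  have h2 := is_const_of_deriv_eq_zero (fun s => (h s).differentiableAt) (fun s => (h s).deriv) x 0
  simp at h2
  linarith

lemma strictMonoOn (hK : IsPotential a K) (ha : 0 < a) {x y z : ℝ} (hx : 0 ≤ x) (hy : 0 < y)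
    (h1 : phase a x y < Real.pi / 2) (h2 : -(Real.pi / 2) < phase a x z) :
    StrictMonoOn (fun s => K (x, s)) (Set.Icc y z) := by
  refine strictMonoOn_of_deriv_pos (convex_Icc y z) (fun s hs =>
    (hK.hasDerivAt_snd x (hy.trans_le hs.1)).continuousAt.continuousWithinAt) (fun s hs => ?_)
  rw [interior_Icc] at hs
  have hs0 := hy.trans hs.1
  rw [(hK.hasDerivAt_snd x hs0).deriv]
  refine mul_pos (amplitude_pos a x hs0) (Real.cos_pos_of_mem_Ioo ⟨?_, ?_⟩)
  · exact h2.trans_le (phase_anti a ha hx hs0 hs.2.le)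
  · exact (phase_anti a ha hx hy hs.1.le).trans_lt h1

lemma sub_const (hK : IsPotential a K) (c : ℝ) : IsPotential a (fun p => K p - c) :=
  fun x y hy => (hK x y hy).sub_const c

lemma hasDerivAt_one (hK : IsPotential a K) (x : ℝ) :
    HasDerivAt (fun s => K (s, 1)) (Real.exp (-(a / 2)) * Real.exp (-(a / 2 * x ^ 2)) *
      (x / (1 + x ^ 2))) x := by
  refine (hK.hasDerivAt_fst x one_pos).congr_deriv ?_
  have h : √(1 + x ^ 2) ≠ 0 := by positivity
  have h' : √(1 + x ^ 2) ^ 2 = 1 + x ^ 2 := Real.sq_sqrt (by positivity)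
  rw [← Real.exp_add]
  simp only [amplitude, phase, sub_self, mul_zero, zero_add, div_one, Real.sin_arctan, one_mul]
  rw [div_mul_div_comm, ← pow_two, h']
  ring_nf

lemma strictMonoOn_one (hK : IsPotential a K) :
    StrictMonoOn (fun s => K (s, 1)) (Set.Ici 0) := by
  refine strictMonoOn_of_deriv_pos (convex_Ici 0) (fun s _ =>
    (hK.hasDerivAt_one s).continuousAt.continuousWithinAt) (fun s hs => ?_)
  rw [interior_Ici, Set.mem_Ioi] at hs
  rw [(hK.hasDerivAt_one s).deriv]
  positivity

lemma exists_tendsto_one (hK : IsPotential a K) (ha : 0 < a) :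
    ∃ l, Tendsto (fun s => K (s, 1)) atTop (𝓝 l) := by
  have hd : ∀ s, HasDerivAt (fun s => K (s, 1) +
      Real.exp (-(a / 2)) * Real.exp (-(a / 2 * s ^ 2)) / a)
      (Real.exp (-(a / 2)) * Real.exp (-(a / 2 * s ^ 2)) * (s / (1 + s ^ 2) - s)) s := fun s => by
    have h1 : HasDerivAt (fun s : ℝ => -(a / 2 * s ^ 2)) (-(a * s)) s :=
      (((hasDerivAt_pow 2 s).const_mul (a / 2)).neg).congr_deriv (by norm_num; ring)
    refine ((hK.hasDerivAt_one s).add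
      ((h1.exp.const_mul (Real.exp (-(a / 2)))).div_const a)).congr_deriv ?_
    field_simp
    ring
  have hanti : AntitoneOn (fun s => K (s, 1) +
      Real.exp (-(a / 2)) * Real.exp (-(a / 2 * s ^ 2)) / a) (Set.Ici 0) := by
    refine antitoneOn_of_deriv_nonpos (convex_Ici 0)
      (fun s _ => (hd s).continuousAt.continuousWithinAt)
      (fun s _ => (hd s).differentiableAt.differentiableWithinAt) (fun s hs => ?_)
    rw [interior_Ici, Set.mem_Ioi] at hs
    rw [(hd s).deriv]
    refine mul_nonpos_of_nonneg_of_nonpos (by positivity) (sub_nonpos.2 ?_)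
    exact div_le_self hs.le (by nlinarith)
  have hmono : Monotone (fun s : ℝ => K (max s 0, 1)) := fun s t hst =>
    hK.strictMonoOn_one.monotoneOn (le_max_right s 0) (le_max_right t 0) (max_le_max_right 0 hst)
  have hbdd : BddAbove (Set.range (fun s : ℝ => K (max s 0, 1))) := by
    refine ⟨K (0, 1) + Real.exp (-(a / 2)) * Real.exp (-(a / 2 * 0 ^ 2)) / a, ?_⟩
    rintro _ ⟨s, rfl⟩
    refine le_trans ?_ (hanti (Set.mem_Ici.2 le_rfl) (le_max_right s 0) (le_max_right s 0))
    exact le_add_of_nonneg_right (by positivity)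
  refine ⟨_, (tendsto_atTop_ciSup hmono hbdd).congr' ?_⟩
  filter_upwards [eventually_ge_atTop 0] with s hs
  rw [max_eq_left hs]

end IsPotential

/-- The level `y` at which the ray `x = m y` meets the curve `phase a x y = 0`. -/
def rayHeight (a m : ℝ) : ℝ := (1 + √(1 + 4 * (Real.arctan m / m) / a)) / 2

lemma arctan_le_self {m : ℝ} (hm : 0 ≤ m) : Real.arctan m ≤ m := by
  by_contra! h
  have h1 : 0 < Real.arctan m := hm.trans_lt h
  have := Real.lt_tan h1 (Real.arctan_lt_pi_div_two m)
  rw [Real.tan_arctan] at this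
  linarith

lemma div_one_add_sq_le_arctan {m : ℝ} (hm : 0 ≤ m) : m / (1 + m ^ 2) ≤ Real.arctan m := by
  have h1 : Real.sin (Real.arctan m) * Real.cos (Real.arctan m) = m / (1 + m ^ 2) := by
    rw [Real.sin_arctan, Real.cos_arctan, div_mul_div_comm, ← pow_two,
      Real.sq_sqrt (by positivity), mul_one]
  have h2 : 0 ≤ Real.arctan m := Real.arctan_nonneg.2 hm
  have h3 := Real.sin_le h2
  have h4 : 0 ≤ Real.sin (Real.arctan m) :=
    Real.sin_nonneg_of_nonneg_of_le_pi h2 (by linarith [Real.arctan_lt_pi_div_two m, Real.pi_pos])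
  have h5 := Real.cos_le_one (Real.arctan m)
  rw [← h1]
  nlinarith

section rayHeight

variable {a m : ℝ}

lemma one_le_rayHeight (ha : 0 < a) (hm : 0 < m) : 1 ≤ rayHeight a m := by
  have h : 0 ≤ Real.arctan m := Real.arctan_nonneg.2 hm.le
  have : 1 ≤ √(1 + 4 * (Real.arctan m / m) / a) :=
    Real.one_le_sqrt.2 (by have : 0 ≤ 4 * (Real.arctan m / m) / a := by positivity
                           linarith)
  unfold rayHeight
  linarith

lemma phase_rayHeight (ha : 0 < a) (hm : 0 < m) :
    phase a (m * rayHeight a m) (rayHeight a m) = 0 := by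
  have h0 : 0 < rayHeight a m := one_pos.trans_le (one_le_rayHeight ha hm)
  have h : 0 ≤ Real.arctan m := Real.arctan_nonneg.2 hm.le
  have hs : √(1 + 4 * (Real.arctan m / m) / a) ^ 2 = 1 + 4 * (Real.arctan m / m) / a :=
    Real.sq_sqrt (by positivity)
  have hq : rayHeight a m * (1 - rayHeight a m) = -(Real.arctan m / m / a) := by
    unfold rayHeight
    linear_combination -hs / 4
  unfold phase
  rw [mul_div_cancel_right₀ _ h0.ne']
  have : a * (m * rayHeight a m) * (1 - rayHeight a m) =
    a * m * (rayHeight a m * (1 - rayHeight a m)) := by ring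
  rw [this, hq]
  field_simp
  norm_num

lemma exists_hasDerivAt_rayHeight (ha : 0 < a) (hm : 0 < m) :
    ∃ v ≤ 0, HasDerivAt (rayHeight a) v m := by
  have h : 0 ≤ Real.arctan m := Real.arctan_nonneg.2 hm.le
  have hpos : 0 < 1 + 4 * (Real.arctan m / m) / a := by positivity
  have h1 := (Real.hasDerivAt_arctan m).div (hasDerivAt_id m) hm.ne'
  have h2 := (((((h1.const_mul 4).div_const a).const_add 1).sqrt hpos.ne').const_add 1).div_const 2
  refine ⟨_, ?_, h2⟩
  have h3 : 1 / (1 + m ^ 2) * m - Real.arctan m * 1 ≤ 0 := by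
    have := div_one_add_sq_le_arctan hm.le
    rw [one_div_mul_eq_div]
    linarith
  refine div_nonpos_of_nonpos_of_nonneg (div_nonpos_of_nonpos_of_nonneg
    (div_nonpos_of_nonpos_of_nonneg (mul_nonpos_of_nonneg_of_nonpos (by norm_num) ?_) ha.le)
    (by positivity)) (by norm_num)
  exact div_nonpos_of_nonpos_of_nonneg h3 (by positivity)

lemma exists_mul_rayHeight_eq (ha : 0 < a) {x : ℝ} (hx : 0 < x) :
    ∃ m, 0 < m ∧ m * rayHeight a m = x := by
  set B : ℝ := (1 + √(1 + 4 / a)) / 2 with hB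
  have hB1 : 1 ≤ B := by
    have : 1 ≤ √(1 + 4 / a) :=
      Real.one_le_sqrt.2 (by have : 0 ≤ 4 / a := by positivity
                             linarith)
    linarith
  have hB0 : 0 < B := by linarith
  have hle : ∀ m, 0 < m → rayHeight a m ≤ B := fun m hm => by
    have : Real.arctan m / m ≤ 1 := (div_le_one hm).2 (arctan_le_self hm.le)
    unfold rayHeight
    rw [hB]
    gcongr
    linarith
  have hxB : x / B ≤ x := div_le_self hx.le hB1
  have hc : ContinuousOn (fun m => m * rayHeight a m) (Set.Icc (x / B) x) := fun m hm => by
    have hm0 : 0 < m := (div_pos hx hB0).trans_le hm.1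
    obtain ⟨v, -, hv⟩ := exists_hasDerivAt_rayHeight ha hm0
    exact (continuousAt_id.mul hv.continuousAt).continuousWithinAt
  have hl : x / B * rayHeight a (x / B) ≤ x := by
    calc x / B * rayHeight a (x / B) ≤ x / B * B := by
          gcongr
          exact hle _ (div_pos hx hB0)
      _ = x := by field_simp
  have hr : x ≤ x * rayHeight a x := le_mul_of_one_le_right hx.le (one_le_rayHeight ha hx)
  obtain ⟨m, hm, he⟩ := intermediate_value_Icc hxB hc ⟨hl, hr⟩
  exact ⟨m, (div_pos hx hB0).trans_le hm.1, he⟩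

end rayHeight

namespace IsPotential

variable {a : ℝ} {K : ℝ × ℝ → ℝ}

lemma apply_one_neg (hK : IsPotential a K)
    (h0 : Tendsto (fun s => K (s, 1)) atTop (𝓝 0)) {x : ℝ} (hx : 0 ≤ x) : K (x, 1) < 0 := by
  have h1 : K (x, 1) < K (x + 1, 1) :=
    hK.strictMonoOn_one hx (Set.mem_Ici.2 (by linarith)) (by linarith)
  refine h1.trans_le (ge_of_tendsto h0 ?_)
  filter_upwards [eventually_ge_atTop (x + 1)] with s hs
  exact hK.strictMonoOn_one.monotoneOn (Set.mem_Ici.2 (by linarith))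
    (Set.mem_Ici.2 (by linarith)) hs

lemma apply_ray_nonneg (hK : IsPotential a K) (ha : 0 < a)
    (h0 : Tendsto (fun s => K (s, 1)) atTop (𝓝 0)) {m : ℝ} (hm : 0 < m) :
    0 ≤ K (m * rayHeight a m, rayHeight a m) := by
  have hd : ∀ m, 0 < m → ∃ v ≤ 0,
      HasDerivAt (fun m => K (m * rayHeight a m, rayHeight a m)) v m := fun m hm => by
    obtain ⟨v, hv0, hv⟩ := exists_hasDerivAt_rayHeight ha hm
    have hpos := one_pos.trans_le (one_le_rayHeight ha hm)
    have h := (hK (m * rayHeight a m) _ hpos).hasFDerivAt.comp_hasDerivAt m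
      (((hasDerivAt_id m).mul hv).prodMk hv)
    refine ⟨_, ?_, h⟩
    simp only [dPotential, phase_rayHeight ha hm]
    simpa using mul_nonpos_of_nonneg_of_nonpos (amplitude_pos a _ hpos).le hv0
  have hanti : AntitoneOn (fun m => K (m * rayHeight a m, rayHeight a m)) (Set.Ioi 0) := by
    refine antitoneOn_of_deriv_nonpos (convex_Ioi 0) (fun m hm => ?_) (fun m hm => ?_)
      (fun m hm => ?_)
    · obtain ⟨v, -, hv⟩ := hd m hm
      exact hv.continuousAt.continuousWithinAt
    · rw [interior_Ioi] at hm
      obtain ⟨v, -, hv⟩ := hd m hm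
      exact hv.differentiableAt.differentiableWithinAt
    · rw [interior_Ioi] at hm
      obtain ⟨v, hv0, hv⟩ := hd m hm
      rwa [hv.deriv]
  have hlim : Tendsto (fun m => m * rayHeight a m) atTop atTop := by
    refine tendsto_atTop_mono' _ ?_ tendsto_id
    filter_upwards [eventually_gt_atTop 0] with s hs
    have := one_le_rayHeight ha hs
    change s ≤ s * rayHeight a s
    nlinarith
  refine le_of_tendsto (h0.comp hlim) ?_
  filter_upwards [eventually_ge_atTop m] with s hs
  have hs0 := hm.trans_le hs
  have h1 := one_le_rayHeight ha hs0
  refine le_trans ?_ (hanti hm hs0 hs)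
  have hx : 0 ≤ s * rayHeight a s := by positivity
  refine (hK.strictMonoOn ha hx one_pos ?_ ?_).monotoneOn
    (Set.left_mem_Icc.2 h1) (Set.right_mem_Icc.2 h1) h1
  · simpa [phase] using Real.arctan_lt_pi_div_two (s * rayHeight a s)
  · rw [phase_rayHeight ha hs0]
    linarith [Real.pi_pos]

lemma exists_apply_zero_nonneg (hK : IsPotential a K) (ha : 0 < a) (h : K (0, 1) < 0) :
    ∃ y, 1 ≤ y ∧ 0 ≤ K (0, y) := by
  set c := Real.exp (-(a / 2)) with hc
  have hc0 : 0 < c := Real.exp_pos _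
  have hd : ∀ s, 0 < s → HasDerivAt (fun s => K (0, s) - c * Real.log s)
      (Real.exp (a / 2 * s ^ 2 - a * s) / s - c * s⁻¹) s := fun s hs => by
    refine ((hK.hasDerivAt_snd 0 hs).sub ((Real.hasDerivAt_log hs.ne').const_mul c)).congr_deriv ?_
    simp [amplitude, phase]
  have hmono : MonotoneOn (fun s => K (0, s) - c * Real.log s) (Set.Ici 1) := by
    refine monotoneOn_of_deriv_nonneg (convex_Ici 1) (fun s hs => ?_) (fun s hs => ?_)
      (fun s hs => ?_)
    · exact (hd s (one_pos.trans_le hs)).continuousAt.continuousWithinAt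
    · rw [interior_Ici] at hs
      exact (hd s (one_pos.trans hs)).differentiableAt.differentiableWithinAt
    · rw [interior_Ici] at hs
      have hs0 : 0 < s := one_pos.trans hs
      rw [(hd s hs0).deriv, ← div_eq_mul_inv, sub_nonneg, hc]
      gcongr
      nlinarith [sq_nonneg (s - 1)]
  have h1 : 1 ≤ Real.exp (-K (0, 1) / c) := Real.one_le_exp (by
    apply div_nonneg <;> linarith)
  refine ⟨Real.exp (-K (0, 1) / c), h1, ?_⟩
  have h2 := hmono (Set.mem_Ici.2 le_rfl) h1 h1
  simp only [Real.log_one, Real.log_exp, mul_div_cancel₀ _ hc0.ne'] at h2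
  linarith

lemma exists_zero (hK : IsPotential a K) (ha : 0 < a)
    (h0 : Tendsto (fun s => K (s, 1)) atTop (𝓝 0)) {x : ℝ} (hx : 0 ≤ x) :
    ∃ y, 1 ≤ y ∧ 0 ≤ phase a x y ∧ phase a x y < Real.pi / 2 ∧ K (x, y) = 0 := by
  obtain ⟨z, hz1, hz2, hz3⟩ : ∃ z, 1 ≤ z ∧ 0 ≤ phase a x z ∧ 0 ≤ K (x, z) := by
    rcases hx.eq_or_lt with rfl | hx
    · obtain ⟨z, hz, hz'⟩ := hK.exists_apply_zero_nonneg ha (hK.apply_one_neg h0 le_rfl)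
      exact ⟨z, hz, by simp [phase], hz'⟩
    · obtain ⟨m, hm, rfl⟩ := exists_mul_rayHeight_eq ha hx
      exact ⟨_, one_le_rayHeight ha hm, (phase_rayHeight ha hm).ge, hK.apply_ray_nonneg ha h0 hm⟩
  have hc : ContinuousOn (fun s => K (x, s)) (Set.Icc 1 z) := fun s hs =>
    (hK.hasDerivAt_snd x (one_pos.trans_le hs.1)).continuousAt.continuousWithinAt
  obtain ⟨y, hy, he⟩ := intermediate_value_Icc hz1 hc ⟨(hK.apply_one_neg h0 hx).le, hz3⟩
  have hy0 := one_pos.trans_le hy.1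
  refine ⟨y, hy.1, hz2.trans (phase_anti a ha hx hy0 hy.2), ?_, he⟩
  refine (phase_anti a ha hx one_pos hy.1).trans_lt ?_
  simpa [phase] using Real.arctan_lt_pi_div_two x

lemma zero_unique (hK : IsPotential a K) (ha : 0 < a) {x y z : ℝ}
    (hy : 0 < y) (hpy : |phase a x y| < Real.pi / 2) (hKy : K (x, y) = 0)
    (hz : 0 < z) (hpz : |phase a x z| < Real.pi / 2) (hKz : K (x, z) = 0) : y = z := by
  wlog hx : 0 ≤ x generalizing x
  · refine this (x := -x) ?_ ?_ ?_ ?_ (by linarith)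
    · rwa [phase_neg, abs_neg]
    · rwa [hK.apply_neg x hy]
    · rwa [phase_neg, abs_neg]
    · rwa [hK.apply_neg x hz]
  wlog hyz : y ≤ z generalizing y z
  · exact (this hz hy hpz hKz hpy hKy (le_of_not_ge hyz)).symm
  exact (hK.strictMonoOn ha hx hy (abs_lt.1 hpy).2 (abs_lt.1 hpz).1).injOn
    (Set.left_mem_Icc.2 hyz) (Set.right_mem_Icc.2 hyz) (hKy.trans hKz.symm)

lemma hasDerivAt_of_zero (hK : IsPotential a K) (ha : 0 < a) {y : ℝ → ℝ}
    (hy : ∀ x, 0 < y x) (hp : ∀ x, |phase a x (y x)| < Real.pi / 2) (hz : ∀ x, K (x, y x) = 0)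
    (x : ℝ) : HasDerivAt y (-Real.tan (phase a x (y x))) x := by
  have hcos : 0 < Real.cos (phase a x (y x)) :=
    Real.cos_pos_of_mem_Ioo (abs_lt.1 (hp x))
  have hA := amplitude_pos a x (hy x)
  set A := amplitude a x (y x) * Real.cos (phase a x (y x)) with hAdef
  have hA0 : A ≠ 0 := (mul_pos hA hcos).ne'
  have hstrict := hK x (y x) (hy x)
  have hinr : dPotential a x (y x) ∘L .inr ℝ ℝ ℝ =
      ((ContinuousLinearEquiv.unitsEquivAut ℝ (Units.mk0 A hA0) : ℝ ≃L[ℝ] ℝ) : ℝ →L[ℝ] ℝ) := by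
    ext
    simp [dPotential, hAdef]
  have hinv : (dPotential a x (y x) ∘L .inr ℝ ℝ ℝ).IsInvertible := ⟨_, hinr.symm⟩
  have hg := (hstrict.hasStrictFDerivAt_implicitFunctionOfProdDomain hinv).hasFDerivAt.hasDerivAt
  have hev := hstrict.eventually_apply_implicitFunctionOfProdDomain hinv
  have htend := hstrict.tendsto_implicitFunctionOfProdDomain hinv
  set g := hstrict.implicitFunctionOfProdDomain hinv
  have hgx : Tendsto (fun s => (s, g s)) (𝓝 x) (𝓝 (x, y x)) := by
    rw [nhds_prod_eq]
    exact tendsto_id.prodMk htend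
  have hpos : ∀ᶠ s in 𝓝 x, 0 < g s := htend.eventually (lt_mem_nhds (hy x))
  have hph : ∀ᶠ s in 𝓝 x, |phase a s (g s)| < Real.pi / 2 :=
    ((continuousAt_phase a (x, y x) (hy x)).abs.tendsto.comp hgx).eventually
      (gt_mem_nhds (hp x))
  have heq : y =ᶠ[𝓝 x] g := by
    filter_upwards [hev, hpos, hph] with s h1 h2 h3
    exact hK.zero_unique ha (hy s) (hp s) (hz s) h2 h3 (h1.trans (hz x))
  refine (hg.congr_of_eventuallyEq heq).congr_deriv ?_
  rw [hinr, ContinuousLinearMap.inverse_equiv]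
  simp [dPotential, Real.tan_eq_sin_div_cos, ContinuousLinearEquiv.unitsEquivAut, hAdef]
  field_simp

end IsPotential

lemma exists_level_curve {a : ℝ} (ha : 0 < a) :
    ∃ y : ℝ → ℝ, (∀ x, y (-x) = y x) ∧ (∀ x, 1 ≤ y x) ∧ (∀ x, 0 ≤ x → 0 ≤ phase a x (y x)) ∧
      (∀ x, |phase a x (y x)| < Real.pi / 2) ∧
      ∀ x, HasDerivAt y (-Real.tan (phase a x (y x))) x := by
  obtain ⟨K₀, hK₀⟩ := exists_isPotential a
  obtain ⟨l, hl⟩ := hK₀.exists_tendsto_one ha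
  have hK := hK₀.sub_const l
  set K := fun p => K₀ p - l
  have h0 : Tendsto (fun s => K (s, 1)) atTop (𝓝 0) := by
    simpa using hl.sub_const l
  choose y hy1 hy2 hy3 hy4 using fun x : ℝ => hK.exists_zero ha h0 (abs_nonneg x)
  have hp : ∀ x, |phase a x (y x)| < Real.pi / 2 := fun x => by
    have h : |phase a |x| (y x)| < Real.pi / 2 := by
      rw [abs_of_nonneg (hy2 x)]
      exact hy3 x
    rcases abs_choice x with hx | hx
    · rwa [hx] at h
    · rwa [hx, phase_neg, abs_neg] at h
  have hz : ∀ x, K (x, y x) = 0 := fun x => by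
    have h := hy4 x
    rcases abs_choice x with hx | hx
    · rwa [hx] at h
    · rwa [hx, hK.apply_neg x (one_pos.trans_le (hy1 x))] at h
  refine ⟨y, fun x => ?_, hy1, fun x hx => ?_, hp, ?_⟩
  · refine hK.zero_unique ha (one_pos.trans_le (hy1 _)) (hp _) (hz _)
      (one_pos.trans_le (hy1 x)) ?_ ?_
    · rw [phase_neg, abs_neg]
      exact hp x
    · rw [hK.apply_neg x (one_pos.trans_le (hy1 x))]
      exact hz x
  · simpa [abs_of_nonneg hx] using hy2 x
  · exact hK.hasDerivAt_of_zero ha (fun x => one_pos.trans_le (hy1 x)) hp hz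

end SteepestDescent

/-- **Proposition `odeprop`.**  For `d, t > 0` with `a = d t²`, there is an even
`C¹` curve `y` with, for `x > 0`, `y′(x) = −tan(a x (1 − y) + arctan(x/y))`, `y′(x) ≤ 0` and
`1 ≤ y ≤ 1 + arctan(x/y)/(a x) ≤ 1 + 1/a`; moreover, with `γ(x) = d t (x − i y(x))` and
`γ′(x) = d t (1 − i y′(x))`, the quantity `exp(−γ²/(2d)) e^{−i t γ} γ′/(2π i γ)` is a
nonnegative real number for every `x`. -/
theorem steepest_descent_contour_exists (d t : ℝ) (hd : 0 < d) (ht : 0 < t) :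
    ∃ y : ℝ → ℝ,
      (∀ x, y (-x) = y x) ∧ ContDiff ℝ 1 y ∧
      (∀ x : ℝ, 0 < x →
        deriv y x = -Real.tan (d * t ^ 2 * x * (1 - y x) + Real.arctan (x / y x)) ∧
        deriv y x ≤ 0 ∧
        1 ≤ y x ∧
        y x ≤ 1 + Real.arctan (x / y x) / (d * t ^ 2 * x) ∧
        1 + Real.arctan (x / y x) / (d * t ^ 2 * x) ≤ 1 + 1 / (d * t ^ 2)) ∧
      (∀ x : ℝ, ∃ r : ℝ, 0 ≤ r ∧
        Complex.exp (-((d : ℂ) * (t : ℂ) * ((x : ℂ) - Complex.I * (y x : ℂ))) ^ 2 /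
              (2 * (d : ℂ))) *
            Complex.exp (-Complex.I * (t : ℂ) *
              ((d : ℂ) * (t : ℂ) * ((x : ℂ) - Complex.I * (y x : ℂ)))) *
            ((d : ℂ) * (t : ℂ) * (1 - Complex.I * ((deriv y x : ℝ) : ℂ))) /
            (2 * (Real.pi : ℂ) * Complex.I *
              ((d : ℂ) * (t : ℂ) * ((x : ℂ) - Complex.I * (y x : ℂ)))) = (r : ℂ)) := by
  have ha : 0 < d * t ^ 2 := by positivity
  obtain ⟨y, heven, hy1, hy2, hy3, hy4⟩ := SteepestDescent.exists_level_curve ha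
  have hy0 : ∀ x, 0 < y x := fun x => one_pos.trans_le (hy1 x)
  have hderiv : ∀ x, deriv y x = -Real.tan (SteepestDescent.phase (d * t ^ 2) x (y x)) :=
    fun x => (hy4 x).deriv
  have hcos : ∀ x, 0 < Real.cos (SteepestDescent.phase (d * t ^ 2) x (y x)) := fun x =>
    Real.cos_pos_of_mem_Ioo (abs_lt.1 (hy3 x))
  refine ⟨y, heven, ?_, fun x hx => ⟨hderiv x, ?_, hy1 x, ?_, ?_⟩, fun x => ?_⟩
  · rw [contDiff_one_iff_deriv]
    refine ⟨fun x => (hy4 x).differentiableAt, ?_⟩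
    rw [funext hderiv, continuous_iff_continuousAt]
    intro x
    have h1 : ContinuousAt (fun s => SteepestDescent.phase (d * t ^ 2) s (y s)) x :=
      (SteepestDescent.continuousAt_phase (d * t ^ 2) (x, y x) (hy0 x)).comp
        (f := fun s => (s, y s)) (continuousAt_id.prodMk (hy4 x).continuousAt)
    exact (ContinuousAt.comp (f := fun s => SteepestDescent.phase (d * t ^ 2) s (y s))
      (Real.continuousAt_tan.2 (hcos x).ne') h1).neg
  · rw [hderiv x, neg_nonpos]
    exact Real.tan_nonneg_of_nonneg_of_le_pi_div_two (hy2 x hx.le) (abs_lt.1 (hy3 x)).2.le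
  · have h := hy2 x hx.le
    unfold SteepestDescent.phase at h
    rw [← sub_le_iff_le_add', le_div_iff₀ (by positivity)]
    linarith
  · have h1 : Real.arctan (x / y x) ≤ x :=
      (SteepestDescent.arctan_le_self (div_nonneg hx.le (hy0 x).le)).trans
        (div_le_self hx.le (hy1 x))
    rw [add_le_add_iff_left, div_le_div_iff₀ (by positivity) ha]
    nlinarith
  · set θ := SteepestDescent.phase (d * t ^ 2) x (y x) with hθ
    have hA := SteepestDescent.amplitude_pos (d * t ^ 2) x (hy0 x)
    refine ⟨SteepestDescent.amplitude (d * t ^ 2) x (y x) / (2 * Real.pi * Real.cos θ),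
      div_nonneg hA.le (mul_nonneg (by positivity) (hcos x).le), ?_⟩
    have hd' : (d : ℂ) ≠ 0 := by exact_mod_cast hd.ne'
    have ht' : (t : ℂ) ≠ 0 := by exact_mod_cast ht.ne'
    have hpi : (Real.pi : ℂ) ≠ 0 := by exact_mod_cast Real.pi_ne_zero
    have hc : (Real.cos θ : ℂ) ≠ 0 := by exact_mod_cast (hcos x).ne'
    have hI := Complex.I_sq
    have hw : (y x : ℂ) + x * Complex.I ≠ 0 := fun h => by
      have := congrArg Complex.re h
      simp at this
      exact (hy0 x).ne' this
    have hγ : (d : ℂ) * t * (x - Complex.I * y x) =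
        -Complex.I * (d * t * (y x + x * Complex.I)) := by
      linear_combination (d * t * x : ℂ) * hI
    have hv : 1 - Complex.I * ((deriv y x : ℝ) : ℂ) =
        Complex.exp (θ * Complex.I) / Real.cos θ := by
      rw [hderiv x, Complex.exp_mul_I, ← Complex.ofReal_cos, ← Complex.ofReal_sin,
        Real.tan_eq_sin_div_cos, ← hθ]
      push_cast at hc ⊢
      field_simp
      ring
    have hexp : Complex.exp (-(-Complex.I * (d * t * (y x + x * Complex.I))) ^ 2 / (2 * d)) *
        Complex.exp (-Complex.I * t * (-Complex.I * (d * t * (y x + x * Complex.I)))) =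
        SteepestDescent.amplitude (d * t ^ 2) x (y x) * Complex.exp (-(θ : ℂ) * Complex.I) *
          (y x + x * Complex.I) := by
      rw [hθ, ← SteepestDescent.integrand_eq _ x (hy0 x), SteepestDescent.integrand,
        div_mul_cancel₀ _ hw, ← Complex.exp_add]
      congr 1
      push_cast
      field_simp
      rw [hI]
      ring
    have hinv : Complex.exp (-(θ : ℂ) * Complex.I) * Complex.exp (θ * Complex.I) = 1 := by
      rw [← Complex.exp_add]
      simp
    rw [hγ, hexp, hv, div_eq_iff]
    · push_cast at hc ⊢
      field_simp
      rw [hI]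
      rw [neg_mul] at hinv
      linear_combination (SteepestDescent.amplitude (d * t ^ 2) x (y x) : ℂ) *
        (y x + x * Complex.I) * hinv
    · simp [hd', ht', hpi, hw]

end
end

section
/- Let d > 0 and t > 0, set a := d·t², let y : ℝ → ℝ be an even continuously differentiable function as produced by the steepest-descent construction — i.e., for x > 0 it satisfies y′(x) = −tan(a·x·(1−y(x)) + arctan(x/y(x))), y′(x) ≤ 0, and 1 ≤ y(x) ≤ 1 + arctan(x/y(x))/(a·x) — and set γ(x) := d·t·(x − i·y(x)) and p₀ := 1 − Φ(√d·t), where Φ is the standard normal distribution function. Then the function h(x) := exp(−γ(x)²/(2d) − i·t·γ(x)) · γ′(x)/(2πi·p₀·γ(x)) is a probability density on ℝ (it is real, nonnegative, and integrates to 1), and it satisfies the pointwise bound h(x) ≤ e^{1/(2·d·t²)} · e^{−d·t²/2}/(2π·p₀) · exp(−d·t²·x²/2) for all x ∈ ℝ. -/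
open MeasureTheory Filter Topology

noncomputable section

/-- The standard normal distribution function `Φ`. -/
def stdNormalCDF (x : ℝ) : ℝ :=
  ∫ t in Set.Iic x, Real.exp (-t ^ 2 / 2) / Real.sqrt (2 * Real.pi)

lemma one_sub_stdNormalCDF (q : ℝ) :
    1 - stdNormalCDF q =
      (∫ u in Set.Ioi q, Real.exp (-u ^ 2 / 2)) / Real.sqrt (2 * Real.pi) := by
  have hgauss : (fun u : ℝ => Real.exp (-u ^ 2 / 2)) = fun u => Real.exp (-(1 / 2) * u ^ 2) := by
    funext u; congr 1; ring
  have hint : Integrable (fun u : ℝ => Real.exp (-u ^ 2 / 2)) := by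
    rw [hgauss]; exact integrable_exp_neg_mul_sq (by norm_num)
  have htotal : ∫ u : ℝ, Real.exp (-u ^ 2 / 2) = Real.sqrt (2 * Real.pi) := by
    rw [hgauss, integral_gaussian]; congr 1; ring
  have hpos : 0 < Real.sqrt (2 * Real.pi) := by positivity
  have hsplit := intervalIntegral.integral_Iic_add_Ioi (b := q) hint.integrableOn hint.integrableOn
  rw [stdNormalCDF, integral_div, ← div_self hpos.ne', ← sub_div]
  congr 1
  linarith

lemma one_sub_stdNormalCDF_pos (q : ℝ) : 0 < 1 - stdNormalCDF q := by
  have hint : Integrable (fun u : ℝ => Real.exp (-u ^ 2 / 2)) := by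
    convert integrable_exp_neg_mul_sq (b := 1 / 2) (by norm_num) using 3
    ring
  rw [one_sub_stdNormalCDF]
  refine div_pos ?_ (by positivity)
  rw [setIntegral_pos_iff_support_of_nonneg_ae
    (Eventually.of_forall fun u => (Real.exp_pos _).le) hint.integrableOn]
  have : Function.support (fun u : ℝ => Real.exp (-u ^ 2 / 2)) = Set.univ :=
    Set.eq_univ_of_forall fun u => (Real.exp_pos _).ne'
  simp [this]

/-- On the steepest-descent curve the integrand, written in the coordinate `y + i x`, has
constant phase. -/
lemma steepest_descent_integrand_eq {a p x Y Y' : ℝ} (hY : 0 < Y)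
    (hcos : Real.cos (a * x * (1 - Y) + Real.arctan (x / Y)) ≠ 0)
    (hY' : Y' = -Real.tan (a * x * (1 - Y) + Real.arctan (x / Y))) :
    Complex.exp (a * (Y + x * Complex.I) ^ 2 / 2 - a * (Y + x * Complex.I)) /
        (Y + x * Complex.I) * (Y' + Complex.I) / (2 * Real.pi * Complex.I * p) =
      ((Real.exp (a / 2 * (Y - 1) ^ 2 - a / 2 - a * x ^ 2 / 2) / (2 * Real.pi * p) *
        (Real.cos (Real.arctan (x / Y)) /
          (Y * Real.cos (a * x * (1 - Y) + Real.arctan (x / Y)))) : ℝ) : ℂ) := by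
  set φ := Real.arctan (x / Y) with hφ
  set θ := a * x * (1 - Y) + φ with hθ
  have hcφ : Real.cos φ ≠ 0 := (Real.cos_arctan_pos _).ne'
  have polar (s : ℝ) (hs : Real.cos s ≠ 0) :
      (1 + Real.tan s * Complex.I : ℂ) = Complex.exp (s * Complex.I) / (Real.cos s : ℂ) := by
    have hs' : (Real.cos s : ℂ) ≠ 0 := by exact_mod_cast hs
    rw [Complex.exp_mul_I, Real.tan_eq_sin_div_cos]
    push_cast at hs' ⊢
    field_simp
  have hw : (Y + x * Complex.I : ℂ) = Y * (Complex.exp (φ * Complex.I) / (Real.cos φ : ℂ)) := by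
    rw [← polar φ hcφ, hφ, Real.tan_arctan]
    have : (Y : ℂ) ≠ 0 := by exact_mod_cast hY.ne'
    push_cast
    field_simp
  have hw' : (Y' + Complex.I : ℂ) =
      Complex.I * (Complex.exp (θ * Complex.I) / (Real.cos θ : ℂ)) := by
    rw [← polar θ hcos, hY']
    push_cast
    linear_combination (-Complex.tan θ) * Complex.I_mul_I
  have hexp : Complex.exp (a * (Y + x * Complex.I) ^ 2 / 2 - a * (Y + x * Complex.I)) =
      Real.exp (a / 2 * (Y - 1) ^ 2 - a / 2 - a * x ^ 2 / 2) *
        (Complex.exp (φ * Complex.I) / Complex.exp (θ * Complex.I)) := by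
    rw [Complex.ofReal_exp, ← Complex.exp_sub, ← Complex.exp_add]
    congr 1
    rw [hθ]
    push_cast
    linear_combination (a * x ^ 2 / 2 : ℂ) * Complex.I_mul_I
  rw [hexp, hw, hw']
  have h1 := Complex.exp_ne_zero (φ * Complex.I)
  have h2 := Complex.exp_ne_zero (θ * Complex.I)
  have h3 : (Real.cos φ : ℂ) ≠ 0 := by exact_mod_cast hcφ
  have h4 : (Real.cos θ : ℂ) ≠ 0 := by exact_mod_cast hcos
  have h5 : (Y : ℂ) ≠ 0 := by exact_mod_cast hY.ne'
  have h6 : (Real.pi : ℂ) ≠ 0 := by exact_mod_cast Real.pi_ne_zero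
  by_cases hp : (p : ℂ) = 0
  · simp [hp]
  rw [Complex.ofReal_mul, Complex.ofReal_div, Complex.ofReal_div, Complex.ofReal_mul,
    Complex.ofReal_mul, Complex.ofReal_mul, Complex.ofReal_ofNat]
  generalize (Real.cos φ : ℂ) = cφ at *
  generalize (Real.cos θ : ℂ) = cθ at *
  field_simp

lemma abs_lt_pi_div_two_of_abs_le_abs_arctan {θ u : ℝ} (h : |θ| ≤ |Real.arctan u|) : |θ| < Real.pi / 2 :=
  h.trans_lt (abs_lt.mpr ⟨Real.neg_pi_div_two_lt_arctan u, Real.arctan_lt_pi_div_two u⟩)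

/-- The bounds on the steepest-descent curve, extended from `x > 0` to the whole line by
symmetry and continuity. -/
lemma steepest_descent_curve_bounds {a : ℝ} (ha : 0 < a) {y : ℝ → ℝ}
    (heven : ∀ x, y (-x) = y x) (hy : Continuous y)
    (hprop : ∀ x : ℝ, 0 < x →
      deriv y x = -Real.tan (a * x * (1 - y x) + Real.arctan (x / y x)) ∧
      1 ≤ y x ∧ y x ≤ 1 + Real.arctan (x / y x) / (a * x)) (x : ℝ) :
    1 ≤ y x ∧ y x ≤ 1 + 1 / a ∧
      |a * x * (1 - y x) + Real.arctan (x / y x)| ≤ |Real.arctan (x / y x)| ∧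
      deriv y x = -Real.tan (a * x * (1 - y x) + Real.arctan (x / y x)) := by
  have hpos (x : ℝ) (hx : 0 < x) : 1 ≤ y x ∧ y x ≤ 1 + 1 / a ∧
      |a * x * (1 - y x) + Real.arctan (x / y x)| ≤ |Real.arctan (x / y x)| ∧
      deriv y x = -Real.tan (a * x * (1 - y x) + Real.arctan (x / y x)) := by
    obtain ⟨h1, h2, h3⟩ := hprop x hx
    have hy0 : 0 < y x := by linarith
    have hat : 0 ≤ Real.arctan (x / y x) := Real.arctan_nonneg.mpr (by positivity)
    have hle : Real.arctan (x / y x) ≤ x :=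
      ((Real.le_tan hat (Real.arctan_lt_pi_div_two _)).trans_eq (Real.tan_arctan _)).trans
        (div_le_self hx.le h2)
    refine ⟨h2, h3.trans ?_, ?_, h1⟩
    · gcongr 1 + ?_
      rw [div_le_div_iff₀ (by positivity) ha]
      nlinarith
    · have h4 : y x - 1 ≤ Real.arctan (x / y x) / (a * x) := by linarith
      rw [le_div_iff₀ (by positivity)] at h4
      have h5 : 0 ≤ a * x * (y x - 1) := mul_nonneg (by positivity) (by linarith)
      rw [abs_of_nonneg hat, abs_of_nonneg (by linarith)]
      linarith
  have hderiv (x : ℝ) : deriv y (-x) = -deriv y x := by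
    have h := deriv_comp_neg y x
    rw [funext heven] at h
    linarith
  rcases lt_trichotomy x 0 with hx | rfl | hx
  · have h := hpos (-x) (by linarith)
    rw [heven, hderiv, neg_div, Real.arctan_neg,
      show a * -x * (1 - y x) + -Real.arctan (x / y x) =
        -(a * x * (1 - y x) + Real.arctan (x / y x)) by ring, Real.tan_neg, abs_neg, abs_neg] at h
    exact ⟨h.1, h.2.1, h.2.2.1, by linarith [h.2.2.2]⟩
  · have hlim : Tendsto y (𝓝[>] 0) (𝓝 (y 0)) := hy.continuousAt.tendsto.mono_left inf_le_left
    refine ⟨ge_of_tendsto hlim ?_, le_of_tendsto hlim ?_, by simp, ?_⟩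
    · filter_upwards [self_mem_nhdsWithin] with x hx using (hpos x hx).1
    · filter_upwards [self_mem_nhdsWithin] with x hx using (hpos x hx).2.1
    · have h := hderiv 0
      rw [neg_zero] at h
      simp only [mul_zero, zero_mul, zero_div, Real.arctan_zero, add_zero, Real.tan_zero, neg_zero]
      linarith
  · exact hpos x hx

/-- Moving the curve `y + i x` to the vertical line `1 + i x` inside the right half-plane does
not change the integral of a holomorphic function that decays at infinity. -/
lemma integral_curve_eq_integral_line {f : ℂ → ℂ} (hf : DifferentiableOn ℂ f {z | 0 < z.re})
    {y : ℝ → ℝ} (hy : ContDiff ℝ 1 y) {M : ℝ} (hy1 : ∀ x, 1 ≤ y x) (hyM : ∀ x, y x ≤ M)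
    {B : ℝ → ℝ} (hB : ∀ x v : ℝ, 1 ≤ v → v ≤ M → ‖f (v + x * Complex.I)‖ ≤ B x)
    (hBtop : Tendsto B atTop (𝓝 0)) (hBbot : Tendsto B atBot (𝓝 0))
    (hcurve : Integrable fun x : ℝ => f (y x + x * Complex.I) * (deriv y x + Complex.I))
    (hline : Integrable fun x : ℝ => f (1 + x * Complex.I) * Complex.I) :
    ∫ x : ℝ, f (y x + x * Complex.I) * (deriv y x + Complex.I) =
      ∫ x : ℝ, f (1 + x * Complex.I) * Complex.I := by
  have hopen : IsOpen {z : ℂ | 0 < z.re} := isOpen_lt continuous_const Complex.continuous_re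
  have hfc : ContinuousOn f {z : ℂ | 0 < z.re} := hf.continuousOn
  have hdy (x : ℝ) : HasDerivAt (fun x : ℝ => (y x + x * Complex.I : ℂ))
      (deriv y x + Complex.I) x := by
    have h1 := ((hy.differentiable one_ne_zero x).hasDerivAt).ofReal_comp
    have h2 := (Complex.ofRealCLM.hasDerivAt (x := x)).mul_const Complex.I
    simp only [Complex.ofRealCLM_apply, Complex.ofReal_one, one_mul] at h2
    exact h1.add h2
  have hd1 (x : ℝ) : HasDerivAt (fun x : ℝ => (1 + x * Complex.I : ℂ)) Complex.I x := by
    have h2 := (Complex.ofRealCLM.hasDerivAt (x := x)).mul_const Complex.I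
    simpa using h2.const_add 1
  have hcontdy : Continuous (deriv y) := hy.continuous_deriv le_rfl
  have hcont1 : Continuous fun x : ℝ => f (y x + x * Complex.I) * (deriv y x + Complex.I) := by
    have hyc := hy.continuous
    refine (hfc.comp_continuous (by fun_prop) fun x => ?_).mul (by fun_prop)
    simpa using zero_lt_one.trans_le (hy1 x)
  have hcont2 : Continuous fun x : ℝ => f (1 + x * Complex.I) * Complex.I := by
    refine (hfc.comp_continuous (by fun_prop) fun x => ?_).mul continuous_const
    simp
  have hM : 1 ≤ M := (hy1 0).trans (hyM 0)
  have hbound (R : ℝ) (hR : 0 ≤ R) :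
      ‖(∫ x in (-R)..R, f (y x + x * Complex.I) * (deriv y x + Complex.I)) -
        ∫ x in (-R)..R, f (1 + x * Complex.I) * Complex.I‖ ≤ (B R + B (-R)) * (M - 1) := by
    set N : ℝ := M ^ 2 + R ^ 2 + 1 with hN
    have hN0 : 0 < N := by positivity
    have hsub : Metric.ball (N : ℂ) N ⊆ {z : ℂ | 0 < z.re} := by
      intro z hz
      rw [Metric.mem_ball, Complex.dist_eq] at hz
      have := (Complex.abs_re_le_norm (z - N)).trans_lt hz
      simp only [Complex.sub_re, Complex.ofReal_re, abs_lt] at this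
      simp only [Set.mem_ofPred_eq]
      linarith
    have hmem (x v : ℝ) (hx : |x| ≤ R) (hv1 : 1 ≤ v) (hvM : v ≤ M) :
        (v + x * Complex.I : ℂ) ∈ Metric.ball (N : ℂ) N := by
      rw [Metric.mem_ball, Complex.dist_eq_re_im, Real.sqrt_lt' hN0]
      simp only [Complex.add_re, Complex.ofReal_re, Complex.mul_re, Complex.I_re, mul_zero,
        Complex.ofReal_im, Complex.I_im, mul_one, sub_self, add_zero, Complex.add_im,
        Complex.mul_im, zero_add, sub_zero]
      have hx2 : x ^ 2 ≤ R ^ 2 := sq_le_sq' (abs_le.mp hx).1 (abs_le.mp hx).2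
      have hv2 : v ^ 2 ≤ M ^ 2 := by nlinarith
      nlinarith
    obtain ⟨G, hG⟩ := (hf.mono hsub).isExactOn_ball
    have hxR (x : ℝ) (hx : x ∈ Set.uIcc (-R) R) : |x| ≤ R := by
      rw [Set.uIcc_of_le (by linarith)] at hx
      exact abs_le.mpr hx
    have e1 : (∫ x in (-R)..R, f (y x + x * Complex.I) * (deriv y x + Complex.I)) =
        G (y R + R * Complex.I) - G (y (-R) + (-R : ℝ) * Complex.I) :=
      intervalIntegral.integral_eq_sub_of_hasDerivAt
        (f := fun x : ℝ => G (y x + x * Complex.I))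
        (fun x hx => (hG _ (hmem x (y x) (hxR x hx) (hy1 x) (hyM x))).comp x (hdy x))
        (hcont1.intervalIntegrable _ _)
    have e2 : (∫ x in (-R)..R, f (1 + x * Complex.I) * Complex.I) =
        G (1 + R * Complex.I) - G (1 + (-R : ℝ) * Complex.I) := by
      refine intervalIntegral.integral_eq_sub_of_hasDerivAt
        (f := fun x : ℝ => G (1 + x * Complex.I))
        (fun x hx => HasDerivAt.comp x (hG _ ?_) (hd1 x)) (hcont2.intervalIntegrable _ _)
      simpa using hmem x 1 (hxR x hx) le_rfl hM
    have hseg (x v : ℝ) (hx : |x| ≤ R) (hv1 : 1 ≤ v) (hvM : v ≤ M) :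
        ‖G (v + x * Complex.I) - G (1 + x * Complex.I)‖ ≤ B x * (M - 1) := by
      have hB0 : 0 ≤ B x := (norm_nonneg _).trans (hB x v hv1 hvM)
      have key := (convex_Icc (1 : ℝ) M).norm_image_sub_le_of_norm_hasDerivWithin_le
        (f := fun u : ℝ => G (u + x * Complex.I)) (f' := fun u : ℝ => f (u + x * Complex.I))
        (C := B x) (x := 1) (y := v) (fun u hu => ?_) (fun u hu => hB x u hu.1 hu.2)
        ⟨le_rfl, hM⟩ ⟨hv1, hvM⟩
      · rw [Complex.ofReal_one, Real.norm_of_nonneg (by linarith)] at key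
        exact key.trans (by gcongr)
      · have h1 := (Complex.ofRealCLM.hasDerivAt (x := u)).add_const (x * Complex.I : ℂ)
        have h2 := (hG _ (hmem x u hx hu.1 hu.2)).comp u h1
        simp only [Complex.ofRealCLM_apply, Complex.ofReal_one, mul_one] at h2
        exact h2.hasDerivWithinAt
    rw [e1, e2]
    calc _ = ‖(G (y R + R * Complex.I) - G (1 + R * Complex.I)) -
          (G (y (-R) + (-R : ℝ) * Complex.I) - G (1 + (-R : ℝ) * Complex.I))‖ := by
            congr 1; ring
      _ ≤ B R * (M - 1) + B (-R) * (M - 1) :=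
          (norm_sub_le _ _).trans (add_le_add
            (hseg R _ (abs_of_nonneg hR).le (hy1 _) (hyM _))
            (hseg (-R) _ (by rw [abs_neg, abs_of_nonneg hR]) (hy1 _) (hyM _)))
      _ = _ := by ring
  have hlim1 := intervalIntegral_tendsto_integral hcurve tendsto_neg_atTop_atBot tendsto_id
  have hlim2 := intervalIntegral_tendsto_integral hline tendsto_neg_atTop_atBot tendsto_id
  have hzero : Tendsto (fun R : ℝ => (B R + B (-R)) * (M - 1)) atTop (𝓝 0) := by
    simpa using (hBtop.add (hBbot.comp tendsto_neg_atTop_atBot)).mul_const (M - 1)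
  have hdiff := squeeze_zero_norm' (by filter_upwards [eventually_ge_atTop 0] using hbound) hzero
  exact sub_eq_zero.mp (tendsto_nhds_unique (hlim1.sub hlim2) hdiff)

lemma integral_exp_neg_sub_sq_div_Ioi {a : ℝ} (ha : 0 < a) :
    ∫ s in Set.Ioi (0 : ℝ), Real.exp (-s - s ^ 2 / (2 * a)) =
      Real.exp (a / 2) * Real.sqrt a * ∫ u in Set.Ioi (Real.sqrt a), Real.exp (-u ^ 2 / 2) := by
  have hsq : Real.sqrt a ^ 2 = a := Real.sq_sqrt ha.le
  have hpos : 0 < Real.sqrt a := Real.sqrt_pos.mpr ha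
  have hscale := integral_comp_mul_left_Ioi' (fun s => Real.exp (-s - s ^ 2 / (2 * a))) 0 hpos
  rw [mul_zero] at hscale
  have hshift := (measurePreserving_add_right volume (Real.sqrt a)).setIntegral_preimage_emb
    (measurableEmbedding_addRight _) (fun u => Real.exp (-u ^ 2 / 2)) (Set.Ioi (Real.sqrt a))
  rw [Set.preimage_add_const_Ioi, sub_self] at hshift
  rw [← hscale, ← hshift, smul_eq_mul, mul_comm (Real.exp _), mul_assoc, ← integral_const_mul (Real.exp _)]
  congr 3
  funext v
  rw [← Real.exp_add]
  congr 1
  rw [mul_pow, hsq]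
  field_simp
  linear_combination hsq

lemma integral_gaussian_div_one_add_mul_I {a : ℝ} (ha : 0 < a) :
    ∫ x : ℝ, (Real.exp (-a * x ^ 2 / 2) : ℂ) / (1 + x * Complex.I) =
      ((2 * Real.pi * Real.exp (a / 2) * (1 - stdNormalCDF (Real.sqrt a)) : ℝ) : ℂ) := by
  have hexp (x : ℝ) : Real.exp (-a * x ^ 2 / 2) = Real.exp (-(a / 2) * x ^ 2) := by
    congr 1; ring
  have hlaplace (x : ℝ) : (Real.exp (-a * x ^ 2 / 2) : ℂ) / (1 + x * Complex.I) =
      ∫ s in Set.Ioi (0 : ℝ),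
        (Real.exp (-a * x ^ 2 / 2) : ℂ) * Complex.exp (-(1 + x * Complex.I) * s) := by
    rw [integral_const_mul, integral_exp_mul_complex_Ioi (by simp)]
    simp [div_eq_mul_inv, neg_inv]
  have hint : Integrable (Function.uncurry fun (x s : ℝ) =>
      (Real.exp (-a * x ^ 2 / 2) : ℂ) * Complex.exp (-(1 + x * Complex.I) * s))
      (volume.prod (volume.restrict (Set.Ioi (0 : ℝ)))) := by
    have h1 : Integrable fun x : ℝ => Real.exp (-a * x ^ 2 / 2) := by
      simp_rw [hexp]; exact integrable_exp_neg_mul_sq (by positivity)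
    have h2 : IntegrableOn (fun s : ℝ => Real.exp (-1 * s)) (Set.Ioi 0) :=
      integrableOn_exp_mul_Ioi (by norm_num) 0
    refine (h1.mul_prod h2).mono' (Continuous.aestronglyMeasurable (by fun_prop)) ?_
    refine Eventually.of_forall fun z => ?_
    simp only [Function.uncurry, norm_mul, Complex.norm_real, Real.norm_eq_abs, Real.abs_exp,
      Complex.norm_exp]
    simp
  have hfourier (s : ℝ) :
      ∫ x : ℝ, (Real.exp (-a * x ^ 2 / 2) : ℂ) * Complex.exp (-(1 + x * Complex.I) * s) =
        ((Real.sqrt (2 * Real.pi / a) * Real.exp (-s - s ^ 2 / (2 * a)) : ℝ) : ℂ) := by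
    have h := fourierIntegral_gaussian (b := ((a / 2 : ℝ) : ℂ)) (by simpa using ha) (-s : ℂ)
    have hK : ((Real.pi : ℂ) / ((a / 2 : ℝ) : ℂ)) ^ (1 / 2 : ℂ) =
        (Real.sqrt (2 * Real.pi / a) : ℂ) := by
      rw [← Complex.ofReal_div, Real.sqrt_eq_rpow, Complex.ofReal_cpow (by positivity)]
      congr 2
      · field_simp
      · norm_num
    rw [hK] at h
    calc _ = ∫ x : ℝ, Complex.exp (-s) * (Complex.exp (Complex.I * -s * x) *
          Complex.exp (-((a / 2 : ℝ) : ℂ) * x ^ 2)) := by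
            congr 1
            funext x
            rw [Complex.ofReal_exp, ← Complex.exp_add, ← Complex.exp_add, ← Complex.exp_add]
            congr 1
            push_cast
            ring
      _ = _ := by
            rw [integral_const_mul, h]
            push_cast
            rw [mul_left_comm, ← Complex.exp_add]
            congr 2
            field_simp
            ring
  simp_rw [hlaplace]
  rw [integral_integral_swap hint]
  simp_rw [hfourier]
  rw [integral_complex_ofReal, integral_const_mul, integral_exp_neg_sub_sq_div_Ioi ha,
    one_sub_stdNormalCDF]
  congr 1
  have h2 : Real.sqrt (2 * Real.pi) ^ 2 = 2 * Real.pi := Real.sq_sqrt (by positivity)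
  have h3 : 0 < Real.sqrt (2 * Real.pi) := by positivity
  have h4 : 0 < Real.sqrt a := by positivity
  rw [Real.sqrt_div (by positivity)]
  field_simp
  rw [h2]

/-- **Corollary `density`.**  With `y` the even `C¹` steepest-descent curve
(for `x > 0`: `y′ = −tan(d t² x (1−y) + arctan(x/y))`, `y′ ≤ 0`,
`1 ≤ y ≤ 1 + arctan(x/y)/(d t² x)`), `γ(x) = d t (x − i y(x))` and `p₀ = 1 − Φ(√d t)`,
the function `h(x) = exp(−γ²/(2d) − i t γ) γ′/(2π i p₀ γ)` is a probability density on `ℝ`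
and satisfies `h(x) ≤ e^{1/(2 d t²)} e^{−d t²/2}/(2π p₀) · exp(−d t² x²/2)`. -/
theorem steepest_descent_density
    (d t : ℝ) (hd : 0 < d) (ht : 0 < t)
    (y : ℝ → ℝ) (heven : ∀ x, y (-x) = y x) (hy : ContDiff ℝ 1 y)
    (hprop : ∀ x : ℝ, 0 < x →
      deriv y x = -Real.tan (d * t ^ 2 * x * (1 - y x) + Real.arctan (x / y x)) ∧
      deriv y x ≤ 0 ∧
      1 ≤ y x ∧
      y x ≤ 1 + Real.arctan (x / y x) / (d * t ^ 2 * x))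
    (h : ℝ → ℂ)
    (hdef : ∀ x : ℝ, h x =
      Complex.exp (-((d : ℂ) * (t : ℂ) * ((x : ℂ) - Complex.I * (y x : ℂ))) ^ 2 /
            (2 * (d : ℂ)) -
          Complex.I * (t : ℂ) * ((d : ℂ) * (t : ℂ) * ((x : ℂ) - Complex.I * (y x : ℂ)))) *
        ((d : ℂ) * (t : ℂ) * (1 - Complex.I * ((deriv y x : ℝ) : ℂ))) /
        (2 * (Real.pi : ℂ) * Complex.I *
          ((1 - stdNormalCDF (Real.sqrt d * t) : ℝ) : ℂ) *
          ((d : ℂ) * (t : ℂ) * ((x : ℂ) - Complex.I * (y x : ℂ))))) :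
    (∀ x, (h x).im = 0) ∧
    (∀ x, 0 ≤ (h x).re) ∧
    (∫ x : ℝ, (h x).re) = 1 ∧
    ∀ x : ℝ, (h x).re ≤
      Real.exp (1 / (2 * d * t ^ 2)) * Real.exp (-(d * t ^ 2) / 2) /
          (2 * Real.pi * (1 - stdNormalCDF (Real.sqrt d * t))) *
        Real.exp (-(d * t ^ 2) * x ^ 2 / 2) := by
  set p : ℝ := 1 - stdNormalCDF (Real.sqrt d * t) with hp
  have hp0 : 0 < p := one_sub_stdNormalCDF_pos _
  obtain ⟨a, ha_def⟩ : ∃ a : ℝ, a = d * t ^ 2 := ⟨_, rfl⟩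
  have ha : 0 < a := by rw [ha_def]; positivity
  have hp_eq : p = 1 - stdNormalCDF (Real.sqrt a) := by
    rw [hp, ha_def, Real.sqrt_mul hd.le, Real.sqrt_sq ht.le]
  have hbounds := steepest_descent_curve_bounds ha heven hy.continuous fun x hx => by
    obtain ⟨h1, -, h2, h3⟩ := hprop x hx
    rw [← ha_def] at h1 h3
    exact ⟨h1, h2, h3⟩
  have hexp_const : Real.exp (1 / (2 * d * t ^ 2)) * Real.exp (-(d * t ^ 2) / 2) =
      Real.exp (1 / (2 * a) - a / 2) := by
    rw [← Real.exp_add, ha_def]; congr 1; field_simp; ring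
  rw [hexp_const, ← ha_def]
  let f : ℂ → ℂ := fun w => Complex.exp (a * w ^ 2 / 2 - a * w) / w
  have hw0 (x : ℝ) : (y x + x * Complex.I : ℂ) ≠ 0 := fun h0 => by
    have := congrArg Complex.re h0
    simp at this
    linarith [(hbounds x).1]
  have hh (x : ℝ) : h x =
      f (y x + x * Complex.I) * (deriv y x + Complex.I) / (2 * Real.pi * Complex.I * p) := by
    have hdC : (d : ℂ) ≠ 0 := by exact_mod_cast hd.ne'
    have htC : (t : ℂ) ≠ 0 := by exact_mod_cast ht.ne'
    have hpC : (p : ℂ) ≠ 0 := by exact_mod_cast hp0.ne'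
    have hpiC : (Real.pi : ℂ) ≠ 0 := by exact_mod_cast Real.pi_ne_zero
    have hz : (x - Complex.I * y x : ℂ) = -Complex.I * (y x + x * Complex.I) := by
      linear_combination (x : ℂ) * Complex.I_mul_I
    have hz' : (1 - Complex.I * deriv y x : ℂ) = -Complex.I * (deriv y x + Complex.I) := by
      linear_combination Complex.I_mul_I
    have hwx := hw0 x
    rw [hdef, hz, hz']
    simp only [f]
    generalize (y x + x * Complex.I : ℂ) = w at hwx ⊢
    generalize (deriv y x + Complex.I : ℂ) = w'
    have hE : -((d : ℂ) * t * (-Complex.I * w)) ^ 2 / (2 * d) -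
        Complex.I * t * (d * t * (-Complex.I * w)) = a * w ^ 2 / 2 - a * w := by
      rw [ha_def]
      push_cast
      field_simp
      simp only [Complex.I_sq]
      ring
    rw [hE]
    have hI := Complex.I_ne_zero
    field_simp
  have hre (x : ℝ) := (hh x).trans (steepest_descent_integrand_eq (p := p)
    (zero_lt_one.trans_le (hbounds x).1)
    (Real.cos_pos_of_mem_Ioo (abs_lt.mp (abs_lt_pi_div_two_of_abs_le_abs_arctan
      (hbounds x).2.2.1))).ne' (hbounds x).2.2.2)
  have hratio (x : ℝ) : 0 ≤ Real.cos (Real.arctan (x / y x)) /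
      (y x * Real.cos (a * x * (1 - y x) + Real.arctan (x / y x))) ∧
      Real.cos (Real.arctan (x / y x)) /
      (y x * Real.cos (a * x * (1 - y x) + Real.arctan (x / y x))) ≤ 1 := by
    obtain ⟨h1, -, h3, -⟩ := hbounds x
    have hθ := Real.cos_pos_of_mem_Ioo (abs_lt.mp (abs_lt_pi_div_two_of_abs_le_abs_arctan h3))
    have hφ := Real.cos_arctan_pos (x / y x)
    have hmono : Real.cos (Real.arctan (x / y x)) ≤
        Real.cos (a * x * (1 - y x) + Real.arctan (x / y x)) := by
      rw [← Real.cos_abs, ← Real.cos_abs (a * x * (1 - y x) + Real.arctan (x / y x))]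
      refine Real.cos_le_cos_of_nonneg_of_le_pi (abs_nonneg _) ?_ h3
      have := abs_lt_pi_div_two_of_abs_le_abs_arctan (le_refl |Real.arctan (x / y x)|)
      linarith [Real.pi_pos]
    have hy0 : 0 < y x := by linarith
    refine ⟨by positivity, ?_⟩
    rw [div_le_one (by positivity)]
    nlinarith
  have hexp (x v : ℝ) (hv1 : 1 ≤ v) (hvM : v ≤ 1 + 1 / a) :
      Real.exp (a / 2 * (v - 1) ^ 2 - a / 2 - a * x ^ 2 / 2) ≤
        Real.exp (1 / (2 * a) - a / 2) * Real.exp (-a * x ^ 2 / 2) := by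
    rw [← Real.exp_add, Real.exp_le_exp]
    have h2 : (v - 1) ^ 2 ≤ (1 / a) ^ 2 := pow_le_pow_left₀ (by linarith) (by linarith) 2
    have h3 : a / 2 * (v - 1) ^ 2 ≤ a / 2 * (1 / a) ^ 2 := by gcongr
    have h4 : a / 2 * (1 / a) ^ 2 = 1 / (2 * a) := by field_simp
    linarith
  have hle (x : ℝ) : (h x).re ≤ Real.exp (1 / (2 * a) - a / 2) / (2 * Real.pi * p) *
      Real.exp (-a * x ^ 2 / 2) := by
    obtain ⟨h1, h2, -, -⟩ := hbounds x
    rw [hre, Complex.ofReal_re]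
    refine (mul_le_of_le_one_right (by positivity) (hratio x).2).trans ?_
    exact (div_le_div_of_nonneg_right (hexp x (y x) h1 h2) (by positivity)).trans_eq
      (div_mul_eq_mul_div _ _ _).symm
  have him (x : ℝ) : (h x).im = 0 := by rw [hre, Complex.ofReal_im]
  have hnonneg (x : ℝ) : 0 ≤ (h x).re := by
    rw [hre, Complex.ofReal_re]
    exact mul_nonneg (by positivity) (hratio x).1
  refine ⟨him, hnonneg, ?_, hle⟩
  have hgauss : Integrable fun x : ℝ => Real.exp (-a * x ^ 2 / 2) := by
    convert integrable_exp_neg_mul_sq (b := a / 2) (by positivity) using 3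
    ring
  have hc : (2 * Real.pi * Complex.I * p : ℂ) ≠ 0 := by
    have hpC : (p : ℂ) ≠ 0 := by exact_mod_cast hp0.ne'
    have hpiC : (Real.pi : ℂ) ≠ 0 := by exact_mod_cast Real.pi_ne_zero
    simp [hpC, hpiC]
  have hcont : Continuous h := by
    rw [funext hh]
    have hyc := hy.continuous
    have hyc' : Continuous (deriv y) := hy.continuous_deriv le_rfl
    have hfc : Continuous fun x : ℝ => f (y x + x * Complex.I) :=
      Continuous.div (by fun_prop) (by fun_prop) hw0
    exact (hfc.mul (by fun_prop)).div_const _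
  have hint : Integrable h := by
    refine (hgauss.const_mul (Real.exp (1 / (2 * a) - a / 2) / (2 * Real.pi * p))).mono'
      hcont.aestronglyMeasurable (Eventually.of_forall fun x => ?_)
    have : h x = ((h x).re : ℂ) := Complex.ext rfl (by simp [him])
    rw [this, Complex.norm_real, Real.norm_of_nonneg (hnonneg x)]
    exact hle x
  have hline (x : ℝ) : f (1 + x * Complex.I) * Complex.I = Complex.I * Real.exp (-a / 2) *
      ((Real.exp (-a * x ^ 2 / 2) : ℂ) / (1 + x * Complex.I)) := by
    have : Complex.exp (a * (1 + x * Complex.I) ^ 2 / 2 - a * (1 + x * Complex.I)) =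
        Real.exp (-a / 2) * Real.exp (-a * x ^ 2 / 2) := by
      rw [Complex.ofReal_exp, Complex.ofReal_exp, ← Complex.exp_add]
      congr 1
      push_cast
      linear_combination (a * x ^ 2 / 2 : ℂ) * Complex.I_mul_I
    simp only [f]
    rw [this]
    ring
  have hfbound (x v : ℝ) (hv1 : 1 ≤ v) (hvM : v ≤ 1 + 1 / a) : ‖f (v + x * Complex.I)‖ ≤
      Real.exp (1 / (2 * a) - a / 2) * Real.exp (-a * x ^ 2 / 2) := by
    have hnorm : 1 ≤ ‖(v + x * Complex.I : ℂ)‖ := by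
      refine hv1.trans ((le_abs_self v).trans ?_)
      simpa using Complex.abs_re_le_norm (v + x * Complex.I)
    have hexpre : ((a : ℂ) * (v + x * Complex.I) ^ 2 / 2 - a * (v + x * Complex.I)).re =
        a / 2 * (v - 1) ^ 2 - a / 2 - a * x ^ 2 / 2 := by
      have : ((a : ℂ) * (v + x * Complex.I) ^ 2 / 2 - a * (v + x * Complex.I)) =
          ((a / 2 * (v - 1) ^ 2 - a / 2 - a * x ^ 2 / 2 : ℝ) : ℂ) +
            ((a * x * (v - 1) : ℝ) : ℂ) * Complex.I := by
        push_cast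
        linear_combination (a * x ^ 2 / 2 : ℂ) * Complex.I_mul_I
      rw [this, Complex.add_re, Complex.ofReal_re, Complex.re_ofReal_mul, Complex.I_re, mul_zero,
        add_zero]
    rw [norm_div, Complex.norm_exp, hexpre]
    exact (div_le_self (Real.exp_pos _).le hnorm).trans (hexp x v hv1 hvM)
  have hf : DifferentiableOn ℂ f {z | 0 < z.re} := fun z hz => by
    have hz0 : z ≠ 0 := fun h0 => by simp [h0] at hz
    exact DifferentiableAt.differentiableWithinAt
      (DifferentiableAt.div (by fun_prop) (by fun_prop) hz0)
  have hdecay {l : Filter ℝ} (hl : Tendsto (fun x : ℝ => x ^ 2) l atTop) : Tendsto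
      (fun x : ℝ => Real.exp (1 / (2 * a) - a / 2) * Real.exp (-a * x ^ 2 / 2)) l (𝓝 0) := by
    have h1 : Tendsto (fun x : ℝ => -(a / 2 * x ^ 2)) l atBot :=
      tendsto_neg_atTop_atBot.comp (hl.const_mul_atTop (by positivity))
    have h2 := (Real.tendsto_exp_atBot.comp h1).const_mul (Real.exp (1 / (2 * a) - a / 2))
    rw [mul_zero] at h2
    refine h2.congr fun x => ?_
    simp only [Function.comp_apply]
    congr 2
    ring
  have hcurve := integral_curve_eq_integral_line hf hy (fun x => (hbounds x).1)
    (fun x => (hbounds x).2.1) hfbound (hdecay (tendsto_pow_atTop two_ne_zero))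
    (hdecay (by
      simpa [Function.comp_def] using
        (tendsto_pow_atTop (α := ℝ) two_ne_zero).comp tendsto_neg_atBot_atTop))
    ((hint.mul_const (2 * Real.pi * Complex.I * p)).congr (Eventually.of_forall fun x => by
      simp only [hh]
      exact div_mul_cancel₀ _ hc))
    ((hgauss.const_mul (Real.exp (1 / (2 * a) - a / 2))).mono'
      (Continuous.aestronglyMeasurable ((hf.continuousOn.comp_continuous (by fun_prop)
        fun x => by simp).mul continuous_const))
      (Eventually.of_forall fun x => by
        rw [norm_mul, Complex.norm_I, mul_one]
        simpa using hfbound x 1 le_rfl (by simp [ha.le])))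
  have htotal : ∫ x : ℝ, h x = 1 := by
    simp_rw [hh]
    rw [integral_div, hcurve]
    simp_rw [hline]
    rw [integral_const_mul, integral_gaussian_div_one_add_mul_I ha, ← hp_eq, div_eq_one_iff_eq hc]
    have hee : (Real.exp (-a / 2) : ℂ) * Real.exp (a / 2) = 1 := by
      rw [← Complex.ofReal_mul, ← Real.exp_add, neg_div, neg_add_cancel, Real.exp_zero,
        Complex.ofReal_one]
    rw [Complex.ofReal_mul, Complex.ofReal_mul, Complex.ofReal_mul, Complex.ofReal_ofNat]
    linear_combination (2 * Real.pi * Complex.I * p : ℂ) * hee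
  have hre_int : ∫ x : ℝ, (h x).re = (∫ x : ℝ, h x).re := integral_re hint
  rw [hre_int, htotal, Complex.one_re]

end
end
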